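/- Let 𝓜 = {M^{(p)} : p > 0} be a weight matrix and 0 < α ≤ 1 be such that lim_{j→∞} (j^{(1-α)j}·M^{(p)}_j)^{1/j} = ∞ for every p > 0, and let 𝓜^α be the associated matrix obtained by log-convex regularization. Then the following are equivalent: (a) 𝓜^α satisfies (𝓜_{rai}); (b) the class A_{{𝓜}}(S_α) is holomorphically closed; (c) the class A_{{𝓜}}(S_α) is inverse-closed. -/

import Mathlib

open Filter Complex Asymptotics
open scoped Topology BigOperators

noncomputable section

/-- The open sector in ℂ of opening `α·π` bisected by the positive real axis. -/
def Sector (α : ℝ) : Set ℂ := {z : ℂ | z ≠ 0 ∧ |Complex.arg z| < α * Real.pi / 2}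

/-- The Roumieu ultraholomorphic class `A_{{M}}(S_α)`. -/
def ASet (M : ℕ → ℝ) (α : ℝ) : Set (ℂ → ℂ) :=
  {f | DifferentiableOn ℂ f (Sector α) ∧
    ∃ h > (0:ℝ), ∃ C : ℝ, ∀ j : ℕ, ∀ z ∈ Sector α,
      ‖iteratedDerivWithin j f (Sector α) z‖ ≤ C * h ^ j * M j}

/-- Equivalence of sequences: `a_j ≤ A·B^j·b_j` and `b_j ≤ A·B^j·a_j`. -/
def SeqEquiv (a b : ℕ → ℝ) : Prop :=
  ∃ A > (0:ℝ), ∃ B > (0:ℝ), ∀ j : ℕ, a j ≤ A * B ^ j * b j ∧ b j ≤ A * B ^ j * a j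

/-- Log-convexity: `L_j² ≤ L_{j-1}·L_{j+1}` for `j ≥ 1`. -/
def IsLogConvexSeq (L : ℕ → ℝ) : Prop := ∀ j : ℕ, L (j+1) ^ 2 ≤ L j * L (j+2)

/-- `Gbar s j = j^{s·j}` (with the convention `0⁰ = 1`, automatic for `rpow`). -/
def Gbar (s : ℝ) (j : ℕ) : ℝ := (j : ℝ) ^ (s * (j : ℝ))

/-- Weight matrix: positive sequences, first term 1, nondecreasing in the parameter. -/
def IsWeightMatrix (M : ℝ → ℕ → ℝ) : Prop :=
  (∀ p > (0:ℝ), ∀ j : ℕ, 0 < M p j) ∧ (∀ p > (0:ℝ), M p 0 = 1) ∧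
    (∀ p q : ℝ, 0 < p → p ≤ q → ∀ j : ℕ, M p j ≤ M q j)

/-- The class `A_{{𝓜}}(S_α)` associated with a weight matrix. -/
def AMatSet (M : ℝ → ℕ → ℝ) (α : ℝ) : Set (ℂ → ℂ) := {f | ∃ p > (0:ℝ), f ∈ ASet (M p) α}

/-- `M̌_j = M_j/j!`. -/
def checkSeq (N : ℕ → ℝ) (j : ℕ) : ℝ := N j / (Nat.factorial j : ℝ)

/-- Condition `(𝓜_{rai})`. -/
def Mrai (M : ℝ → ℕ → ℝ) : Prop :=
  ∀ p > (0:ℝ), ∃ C > (0:ℝ), ∃ p' > (0:ℝ), ∀ j k : ℕ, 1 ≤ j → j ≤ k →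
    (checkSeq (M p) j) ^ ((j:ℝ)⁻¹) ≤ C * (checkSeq (M p') k) ^ ((k:ℝ)⁻¹)

/-- Condition `(𝓜_{C^ω})`. -/
def MComega (M : ℝ → ℕ → ℝ) : Prop :=
  ∃ p > (0:ℝ),
    0 < Filter.liminf (fun j : ℕ => (checkSeq (M p) j) ^ ((j:ℝ)⁻¹)) Filter.atTop

/-- Condition `(𝓜_{dc})`. -/
def Mdc (M : ℝ → ℕ → ℝ) : Prop :=
  ∀ p > (0:ℝ), ∃ C > (0:ℝ), ∃ p' > (0:ℝ), ∀ j : ℕ, M p (j+1) ≤ C ^ (j+1) * M p' j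

/-- `N°_k`: maximum of `N_ℓ·N_{j₁}⋯N_{j_ℓ}` over `j_i ∈ ℕ, j₁+⋯+j_ℓ = k`; `N°₀ = 1`. -/
def circSeq (N : ℕ → ℝ) (k : ℕ) : ℝ :=
  if k = 0 then 1 else
    sSup {x : ℝ | ∃ (l : ℕ) (js : Fin l → ℕ), (∀ i, 1 ≤ js i) ∧ (∑ i, js i) = k ∧
      x = N l * ∏ i, N (js i)}

/-- `(rai)` for a single sequence. -/
def SeqRai (N : ℕ → ℝ) : Prop :=
  ∃ C > (0:ℝ), ∀ j k : ℕ, 1 ≤ j → j ≤ k →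
    (checkSeq N j) ^ ((j:ℝ)⁻¹) ≤ C * (checkSeq N k) ^ ((k:ℝ)⁻¹)

/-- `(dc)` for a single sequence. -/
def SeqDc (N : ℕ → ℝ) : Prop := ∃ D ≥ (1:ℝ), ∀ j : ℕ, N (j+1) ≤ D ^ (j+1) * N j

/-- `(FdB)` for a single sequence. -/
def SeqFdB (N : ℕ → ℝ) : Prop :=
  ∃ C ≥ (1:ℝ), ∃ h ≥ (1:ℝ), ∀ j : ℕ, circSeq (checkSeq N) j ≤ C * h ^ j * checkSeq N j

/-- Condition `(𝓜_{FdB})`. -/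
def MFdB (M : ℝ → ℕ → ℝ) : Prop :=
  ∀ p > (0:ℝ), ∃ p' > (0:ℝ), ∃ C : ℝ, ∀ k : ℕ, 1 ≤ k →
    (circSeq (checkSeq (M p)) k / checkSeq (M p') k) ^ ((k:ℝ)⁻¹) ≤ C

/-- `L` is the log-convex minorant of `a` (within positive log-convex sequences). -/
def IsLcMinorant (a L : ℕ → ℝ) : Prop :=
  (∀ j, 0 < L j) ∧ IsLogConvexSeq L ∧ (∀ j, L j ≤ a j) ∧
    ∀ L' : ℕ → ℝ, (∀ j, 0 < L' j) → IsLogConvexSeq L' → (∀ j, L' j ≤ a j) → ∀ j, L' j ≤ L j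

/-- Holomorphic closedness of a class of functions on `S_α`. -/
def HolClosed (S : Set (ℂ → ℂ)) (α : ℝ) : Prop :=
  ∀ f ∈ S, ∀ U : Set ℂ, IsOpen U → closure (f '' Sector α) ⊆ U →
    ∀ g : ℂ → ℂ, DifferentiableOn ℂ g U → g ∘ f ∈ S

/-- Inverse closedness of a class of functions on `S_α`. -/
def InvClosed (S : Set (ℂ → ℂ)) (α : ℝ) : Prop :=
  ∀ f ∈ S, (∃ c > (0:ℝ), ∀ z ∈ Sector α, c ≤ ‖f z‖) → (fun z => (f z)⁻¹) ∈ S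

/-- The class `H_{{𝓜}}(U)` for a weight matrix. -/
def HMatClass (M : ℝ → ℕ → ℝ) (U : Set ℂ) : Set (ℂ → ℂ) :=
  {g | DifferentiableOn ℂ g U ∧ ∀ K : Set ℂ, K ⊆ U → IsCompact K →
    ∃ p > (0:ℝ), ∃ h > (0:ℝ), ∃ C : ℝ, ∀ j : ℕ, ∀ z ∈ K,
      ‖iteratedDerivWithin j g U z‖ ≤ C * h ^ j * M p j}

/-- The class `H_{{M}}(U)` for a single sequence. -/
def HSeqClass (N : ℕ → ℝ) (U : Set ℂ) : Set (ℂ → ℂ) :=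
  {g | DifferentiableOn ℂ g U ∧ ∀ K : Set ℂ, K ⊆ U → IsCompact K →
    ∃ h > (0:ℝ), ∃ C : ℝ, ∀ j : ℕ, ∀ z ∈ K,
      ‖iteratedDerivWithin j g U z‖ ≤ C * h ^ j * N j}

/-- Closedness under composition for the matrix class. -/
def CompClosedMat (M : ℝ → ℕ → ℝ) (α : ℝ) : Prop :=
  ∀ f ∈ AMatSet M α, ∀ U : Set ℂ, IsOpen U → closure (f '' Sector α) ⊆ U →
    ∀ g ∈ HMatClass M U, g ∘ f ∈ AMatSet M α

/-- Closedness under composition for a single-sequence class. -/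
def CompClosedSeq (N : ℕ → ℝ) (α : ℝ) : Prop :=
  ∀ f ∈ ASet N α, ∀ U : Set ℂ, IsOpen U → closure (f '' Sector α) ⊆ U →
    ∀ g ∈ HSeqClass N U, g ∘ f ∈ ASet N α

/-- `f` is characteristic in `A_{{L}}(S_α)`. -/
def Characteristic (L : ℕ → ℝ) (α : ℝ) (f : ℂ → ℂ) : Prop :=
  f ∈ ASet L α ∧ ∀ N : ℕ → ℝ, (∀ j, 0 < N j) → N 0 = 1 →
    f ∈ ASet N α → ASet N α ⊆ ASet L α → ASet N α = ASet L α

/-- Coefficient `2^{-n} M_n/m_n^n` of the `T_M`-transform. -/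
def coefT (M : ℕ → ℝ) (n : ℕ) : ℝ := (1/2:ℝ)^n * (M n / (M (n+1) / M n) ^ n)

/-- The sequence of quotients `m_n = M_{n+1}/M_n`. -/
def quotSeq (M : ℕ → ℝ) (n : ℕ) : ℝ := M (n+1) / M n

/-- `R_j = ∑ 2^{-n}(M_n/m_n^n) m_n^j` (as a real tsum). -/
def Rseq (M : ℕ → ℝ) (j : ℕ) : ℝ := ∑' n : ℕ, coefT M n * (quotSeq M n) ^ j

/-- The `T_M`-transform. -/
def Ttrans (M : ℕ → ℝ) (f : ℂ → ℂ) (z : ℂ) : ℂ :=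
  ∑' n : ℕ, (coefT M n : ℂ) * f ((quotSeq M n : ℂ) * z)

/-- Weight function: continuous, nondecreasing, `ω(0)=0`, nonnegative, `ω(t)→∞`. -/
def IsWeightFunction (ω : ℝ → ℝ) : Prop :=
  ContinuousOn ω (Set.Ici 0) ∧ MonotoneOn ω (Set.Ici 0) ∧ ω 0 = 0 ∧
    (∀ t ≥ (0:ℝ), 0 ≤ ω t) ∧ Filter.Tendsto ω Filter.atTop Filter.atTop

def Om0 (ω : ℝ → ℝ) : Prop := ∀ t ∈ Set.Icc (0:ℝ) 1, ω t = 0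
def Om1 (ω : ℝ → ℝ) : Prop := ∃ L ≥ (1:ℝ), ∀ t ≥ (0:ℝ), ω (2*t) ≤ L * (ω t + 1)
def Om2 (ω : ℝ → ℝ) : Prop := ∃ C > (0:ℝ), ∃ t₀ : ℝ, ∀ t ≥ t₀, ω t ≤ C * t
def Om3 (ω : ℝ → ℝ) : Prop := Real.log =o[Filter.atTop] ω
def Om4 (ω : ℝ → ℝ) : Prop := ConvexOn ℝ Set.univ (fun t => ω (Real.exp t))
def Om5 (ω : ℝ → ℝ) : Prop := ω =o[Filter.atTop] (fun t => t)
def Om6 (ω : ℝ → ℝ) : Prop := ∃ H ≥ (1:ℝ), ∀ t ≥ (0:ℝ), 2 * ω t ≤ ω (H * t) + H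

/-- Condition `(α₀)` for a weight function. -/
def Alpha0 (ω : ℝ → ℝ) : Prop :=
  ∃ C ≥ (1:ℝ), ∃ t₀ ≥ (0:ℝ), ∀ lam ≥ (1:ℝ), ∀ t ≥ t₀, ω (lam * t) ≤ C * lam * ω t

/-- The set `W₀`. -/
def InW0 (ω : ℝ → ℝ) : Prop := IsWeightFunction ω ∧ Om0 ω ∧ Om3 ω ∧ Om4 ω

/-- The set `W`. -/
def InW (ω : ℝ → ℝ) : Prop := InW0 ω ∧ Om1 ω

/-- The Legendre–Fenchel–Young conjugate `φ*_ω`. -/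
def phiStar (ω : ℝ → ℝ) (x : ℝ) : ℝ :=
  sSup {r : ℝ | ∃ y : ℝ, 0 ≤ y ∧ r = x * y - ω (Real.exp y)}

/-- The weight matrix associated with `ω`: `W^{(ℓ)}_j = exp((1/ℓ)·φ*_ω(ℓj))`. -/
def Wmat (ω : ℝ → ℝ) (ℓ : ℝ) (j : ℕ) : ℝ := Real.exp ((1/ℓ) * phiStar ω (ℓ * (j:ℝ)))

/-- The class `A_{{ω}}(S_α)`. -/
def AOmegaSet (ω : ℝ → ℝ) (α : ℝ) : Set (ℂ → ℂ) :=
  {f | DifferentiableOn ℂ f (Sector α) ∧ ∃ ℓ > (0:ℝ), ∃ C : ℝ,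
    ∀ j : ℕ, ∀ z ∈ Sector α, ‖iteratedDerivWithin j f (Sector α) z‖ ≤ C * Wmat ω ℓ j}

/-- Closedness under composition for the `ω`-class. -/
def CompClosedOmega (ω : ℝ → ℝ) (α : ℝ) : Prop :=
  ∀ f ∈ AOmegaSet ω α, ∀ U : Set ℂ, IsOpen U → closure (f '' Sector α) ⊆ U →
    ∀ g ∈ HMatClass (Wmat ω) U, g ∘ f ∈ AOmegaSet ω α

/-- One-sided matrix comparison `𝓜 {⪯} 𝓛`: `sup_{j≥1}(M^{(p)}_j/L^{(q)}_j)^{1/j} < ∞`. -/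
def MatPreceq (M L : ℝ → ℕ → ℝ) : Prop :=
  ∀ p > (0:ℝ), ∃ q > (0:ℝ), ∃ C : ℝ, ∀ j : ℕ, 1 ≤ j → (M p j / L q j) ^ ((j:ℝ)⁻¹) ≤ C

/-- `R`-equivalence of weight matrices. -/
def REquivMat (M L : ℝ → ℕ → ℝ) : Prop := MatPreceq M L ∧ MatPreceq L M

namespace UH

/-- The half-opening angle of the dual sector. -/
def ang (α : ℝ) : ℝ := (1 - α) * Real.pi / 2

/-- rotated real part `Re (z e^{i s})` -/
def rp (s : ℝ) (z : ℂ) : ℝ := z.re * Real.cos s - z.im * Real.sin s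

lemma rp_add (s : ℝ) (z w : ℂ) : rp s (z + w) = rp s z + rp s w := by
  simp [rp]; ring

lemma rp_smul (s t : ℝ) (z : ℂ) : rp s ((t : ℂ) * z) = t * rp s z := by
  simp [rp]; ring

lemma rp_polar (s r θ : ℝ) : rp s ((r : ℂ) * Complex.exp (θ * I)) = r * Real.cos (θ + s) := by
  rw [rp_smul, rp, Complex.exp_ofReal_mul_I_re, Complex.exp_ofReal_mul_I_im, Real.cos_add]

lemma rp_continuous (s : ℝ) : Continuous (rp s) := by
  unfold rp; fun_prop

lemma abs_rp_le (s : ℝ) (z : ℂ) : |rp s z| ≤ ‖z‖ := by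
  have h : z = (‖z‖ : ℂ) * Complex.exp (z.arg * I) := by
    rw [Complex.norm_mul_exp_arg_mul_I]
  conv_lhs => rw [h]
  rw [rp_polar, abs_mul, abs_of_nonneg (norm_nonneg z)]
  exact mul_le_of_le_one_right (norm_nonneg _) (Real.abs_cos_le_one _)

lemma ang_nonneg {α : ℝ} (h : α ≤ 1) : 0 ≤ ang α := by
  unfold ang; have := Real.pi_pos; have : 0 ≤ 1 - α := by linarith
  positivity

lemma ang_lt {α : ℝ} (h : 0 < α) : ang α < Real.pi / 2 := by
  unfold ang; nlinarith [Real.pi_pos]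

lemma mem_sector_iff {α : ℝ} (h0 : 0 < α) (h1 : α ≤ 1) (z : ℂ) :
    z ∈ Sector α ↔ 0 < rp (ang α) z ∧ 0 < rp (-ang α) z := by
  have hs0 := ang_nonneg h1
  have hs1 := ang_lt h0
  have hsum : α * Real.pi / 2 = Real.pi / 2 - ang α := by unfold ang; ring
  have hpi := Real.pi_pos
  have hz : z = (‖z‖ : ℂ) * Complex.exp (z.arg * I) := by
    rw [Complex.norm_mul_exp_arg_mul_I]
  have e1 : ∀ s, rp s z = ‖z‖ * Real.cos (z.arg + s) := by
    intro s
    conv_lhs => rw [hz]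
    exact rp_polar _ _ _
  have hθ1 := Complex.neg_pi_lt_arg z
  have hθ2 := Complex.arg_le_pi z
  rw [e1, e1]
  constructor
  · rintro ⟨hz0, hz1⟩
    have hn : 0 < ‖z‖ := norm_pos_iff.2 hz0
    rw [hsum, abs_lt] at hz1
    constructor <;> refine mul_pos hn (Real.cos_pos_of_mem_Ioo ⟨?_, ?_⟩) <;> linarith
  · rintro ⟨h1, h2⟩
    have hz0 : z ≠ 0 := by
      rintro rfl; simp at h1
    have hn : 0 < ‖z‖ := norm_pos_iff.2 hz0
    have c1 := (mul_pos_iff_of_pos_left hn).1 h1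
    have c2 := (mul_pos_iff_of_pos_left hn).1 h2
    refine ⟨hz0, ?_⟩
    rw [hsum, abs_lt]
    constructor
    · by_contra hcon
      push Not at hcon
      have : Real.cos (-(z.arg + -ang α)) ≤ 0 :=
        Real.cos_nonpos_of_pi_div_two_le_of_le (by linarith) (by linarith)
      rw [Real.cos_neg] at this
      linarith
    · by_contra hcon
      push Not at hcon
      have : Real.cos ((z.arg + ang α)) ≤ 0 :=
        Real.cos_nonpos_of_pi_div_two_le_of_le (by linarith) (by linarith)
      linarith

/-- closed sector -/
def CSec (α : ℝ) : Set ℂ := {z | 0 ≤ rp (ang α) z ∧ 0 ≤ rp (-ang α) z}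

section

lemma sector_open {α : ℝ} (h0 : 0 < α) (h1 : α ≤ 1) : IsOpen (Sector α) := by
  have : Sector α = {z | 0 < rp (ang α) z} ∩ {z | 0 < rp (-ang α) z} := by
    ext z; rw [mem_sector_iff h0 h1]; rfl
  rw [this]
  exact (isOpen_lt continuous_const (rp_continuous _)).inter
    (isOpen_lt continuous_const (rp_continuous _))

lemma sector_convex {α : ℝ} (h0 : 0 < α) (h1 : α ≤ 1) : Convex ℝ (Sector α) := by
  intro x hx y hy a b ha hb hab
  rw [mem_sector_iff h0 h1] at *
  have e : ∀ (t : ℝ) (z : ℂ), t • z = (t : ℂ) * z := fun t z => by simp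
  simp only [e, rp_add, rp_smul]
  rcases ha.eq_or_lt with rfl | ha'
  · have : b = 1 := by linarith
    subst this; simpa using hy
  · exact ⟨add_pos_of_pos_of_nonneg (mul_pos ha' hx.1) (mul_nonneg hb hy.1.le),
      add_pos_of_pos_of_nonneg (mul_pos ha' hx.2) (mul_nonneg hb hy.2.le)⟩

lemma sector_add {α : ℝ} (h0 : 0 < α) (h1 : α ≤ 1) {z w : ℂ} (hz : z ∈ Sector α) (hw : w ∈ CSec α) : z + w ∈ Sector α := by
  rw [mem_sector_iff h0 h1] at *
  rw [rp_add, rp_add]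
  exact ⟨add_pos_of_pos_of_nonneg hz.1 hw.1, add_pos_of_pos_of_nonneg hz.2 hw.2⟩

lemma sector_smul {α : ℝ} (h0 : 0 < α) (h1 : α ≤ 1) {z : ℂ} {t : ℝ} (ht : 0 < t) (hz : z ∈ Sector α) : (t : ℂ) * z ∈ Sector α := by
  rw [mem_sector_iff h0 h1] at *
  rw [rp_smul, rp_smul]
  exact ⟨mul_pos ht hz.1, mul_pos ht hz.2⟩

lemma pos_mem_sector {α : ℝ} (h0 : 0 < α) (h1 : α ≤ 1) {t : ℝ} (ht : 0 < t) : (t : ℂ) ∈ Sector α := by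
  refine ⟨by exact_mod_cast ht.ne', ?_⟩
  rw [Complex.arg_ofReal_of_nonneg ht.le]
  simp; positivity

lemma csec_smul {α : ℝ} {z : ℂ} {t : ℝ} (ht : 0 ≤ t) (hz : z ∈ CSec α) : (t : ℂ) * z ∈ CSec α := by
  unfold CSec at *
  simp only [Set.mem_setOf_eq, rp_smul] at *
  exact ⟨mul_nonneg ht hz.1, mul_nonneg ht hz.2⟩

lemma polar_mem_csec {α : ℝ} (h0 : 0 < α) (h1 : α ≤ 1) {r θ : ℝ} (hr : 0 ≤ r) (hθ : |θ| ≤ α * Real.pi / 2) :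
    (r : ℂ) * Complex.exp (θ * I) ∈ CSec α := by
  have hs0 := ang_nonneg h1
  have hs1 := ang_lt h0
  have hsum : α * Real.pi / 2 = Real.pi / 2 - ang α := by unfold ang; ring
  rw [hsum, abs_le] at hθ
  unfold CSec
  simp only [Set.mem_setOf_eq, rp_polar]
  constructor <;> refine mul_nonneg hr (Real.cos_nonneg_of_mem_Icc ⟨?_, ?_⟩) <;> linarith

lemma disc_sub_csec {α : ℝ} (h0 : 0 < α) (h1 : α ≤ 1) : ∃ δ : ℝ, 0 < δ ∧ δ ≤ 1/2 ∧ ∀ v : ℂ, ‖v‖ ≤ δ →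
    (1/2 : ℂ) + v ∈ CSec α ∧ ‖(1/2 : ℂ) + v‖ ≤ 1 := by
  have hs0 := ang_nonneg h1
  have hs1 := ang_lt h0
  have hc : 0 < Real.cos (ang α) := Real.cos_pos_of_mem_Ioo ⟨by linarith, hs1⟩
  have hc1 := Real.cos_le_one (ang α)
  refine ⟨Real.cos (ang α) / 2, by linarith, by linarith, fun v hv => ⟨?_, ?_⟩⟩
  · have a1 := abs_le.1 (abs_rp_le (ang α) v)
    have a2 := abs_le.1 (abs_rp_le (-ang α) v)
    unfold CSec
    simp only [Set.mem_setOf_eq, rp_add]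
    have e : ∀ s, rp s (1/2 : ℂ) = Real.cos s / 2 := by
      intro s; simp [rp]; ring
    rw [e, e, Real.cos_neg]
    constructor <;> linarith
  · calc ‖(1/2 : ℂ) + v‖ ≤ ‖(1/2 : ℂ)‖ + ‖v‖ := norm_add_le _ _
      _ ≤ 1/2 + 1/2 := by
        gcongr
        · simp
        · linarith
      _ = 1 := by norm_num

end

end UH

namespace UH

lemma poly_iteratedDeriv (P : Polynomial ℂ) (k : ℕ) :
    iteratedDeriv k (fun w => P.eval w) = fun w => (Polynomial.derivative^[k] P).eval w := by
  induction k with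
  | zero => simp
  | succ k ih =>
    rw [iteratedDeriv_succ, ih]
    ext w
    rw [Polynomial.deriv, Function.iterate_succ_apply']

lemma poly_iteratedDeriv_zero (P : Polynomial ℂ) (k : ℕ) :
    iteratedDeriv k (fun w => P.eval w) 0 = k.factorial * P.coeff k := by
  rw [poly_iteratedDeriv]
  show (Polynomial.derivative^[k] P).eval 0 = _
  rw [← Polynomial.coeff_zero_eq_eval_zero, Polynomial.coeff_iterate_derivative]
  simp [Nat.descFactorial_self]

lemma poly_coeff_le (P : Polynomial ℂ) {R A : ℝ} (hR : 0 < R)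
    (h : ∀ w : ℂ, ‖w‖ = R → ‖P.eval w‖ ≤ A) (k : ℕ) : ‖P.coeff k‖ ≤ A / R ^ k := by
  have h1 : ‖iteratedDeriv k (fun w => P.eval w) 0‖ ≤ k.factorial * A / R ^ k := by
    refine Complex.norm_iteratedDeriv_le_of_forall_mem_sphere_norm_le k hR ?_ ?_
    · exact P.differentiable.diffContOnCl
    · intro z hz
      exact h z (by simpa using hz)
  rw [poly_iteratedDeriv_zero, norm_mul, Complex.norm_natCast] at h1
  have hk : (0 : ℝ) < k.factorial := by exact_mod_cast Nat.factorial_pos k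
  rw [mul_div_assoc] at h1
  exact le_of_mul_le_mul_left h1 hk

/-- crude growth bound -/
lemma poly_crude {α : ℝ} (h0 : 0 < α) (h1 : α ≤ 1) : ∃ K : ℝ, 1 < K ∧
    ∀ (n : ℕ) (P : Polynomial ℂ) (A : ℝ), 1 ≤ n → P.natDegree ≤ n → 
      (∀ w ∈ CSec α, ‖w‖ ≤ 1 → ‖P.eval w‖ ≤ A) → ∀ w : ℂ, ‖w‖ ≤ 1 → ‖P.eval w‖ ≤ A * K ^ n := by
  obtain ⟨δ, hδ0, hδ1, hδ⟩ := disc_sub_csec h0 h1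
  have hone : 1 ≤ 2 / δ := by rw [le_div_iff₀ hδ0]; linarith
  refine ⟨2 * (2 / δ), by linarith, ?_⟩
  intro n P A hn hdeg hP w hw
  set Q := P.comp (Polynomial.X + Polynomial.C (1/2)) with hQ
  have hQe : ∀ v, Q.eval v = P.eval (1/2 + v) := by
    intro v; simp [hQ, Polynomial.eval_comp, add_comm]
  have hA : 0 ≤ A := (norm_nonneg _).trans
    (hP (1/2 + 0) (hδ 0 (by simpa using hδ0.le)).1 (hδ 0 (by simpa using hδ0.le)).2)
  have hQd : Q.natDegree ≤ n := by
    refine (Polynomial.natDegree_comp_le).trans ?_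
    have : (Polynomial.X + Polynomial.C (1/2 : ℂ)).natDegree = 1 := Polynomial.natDegree_X_add_C _
    rw [this, mul_one]; exact hdeg
  have hc : ∀ k, ‖Q.coeff k‖ ≤ A / δ ^ k := by
    apply poly_coeff_le Q hδ0
    intro v hv
    rw [hQe]
    exact hP _ (hδ v hv.le).1 (hδ v hv.le).2
  have hv : ‖w - 1/2‖ ≤ 2 := by
    refine (norm_sub_le _ _).trans ?_
    have : ‖(1/2 : ℂ)‖ = 1/2 := by simp
    rw [this]; linarith
  have : P.eval w = Q.eval (w - 1/2) := by rw [hQe]; congr 1; ring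
  rw [this, Polynomial.eval_eq_sum_range' (Nat.lt_succ_of_le hQd)]
  calc ‖∑ i ∈ Finset.range n.succ, Q.coeff i * (w - 1/2) ^ i‖ 
      ≤ ∑ i ∈ Finset.range n.succ, A * (2 / δ) ^ n := by
        refine norm_sum_le_of_le _ fun i hi => ?_
        have hi' : i ≤ n := Nat.lt_succ_iff.1 (Finset.mem_range.1 hi)
        rw [norm_mul, norm_pow]
        calc ‖Q.coeff i‖ * ‖w - 1/2‖ ^ i ≤ A / δ ^ i * 2 ^ i := by
              gcongr
              exact hc i
          _ = A * (2 / δ) ^ i := by rw [div_pow]; ring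
          _ ≤ A * (2 / δ) ^ n := by gcongr
    _ = (n + 1 : ℝ) * (A * (2 / δ) ^ n) := by simp
    _ ≤ 2 ^ n * (A * (2 / δ) ^ n) := by
        gcongr
        exact_mod_cast Nat.lt_two_pow_self
    _ = A * (2 * (2 / δ)) ^ n := by rw [mul_pow]; ring

def HalfDisc : Set ℂ := {ζ | 0 < ζ.re} ∩ Metric.ball 0 1

lemma halfDisc_open : IsOpen HalfDisc :=
  (isOpen_lt continuous_const Complex.continuous_re).inter Metric.isOpen_ball

lemma halfDisc_closure : closure HalfDisc ⊆ {ζ | 0 ≤ ζ.re ∧ ‖ζ‖ ≤ 1} := by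
  have hc : IsClosed {ζ : ℂ | 0 ≤ ζ.re ∧ ‖ζ‖ ≤ 1} :=
    (isClosed_le continuous_const Complex.continuous_re).inter
      (isClosed_le continuous_norm continuous_const)
  refine closure_minimal ?_ hc
  rintro ζ ⟨h1, h2⟩
  exact ⟨le_of_lt h1, by simpa using (le_of_lt (by simpa using h2 : ‖ζ‖ < 1))⟩

lemma halfDisc_closure' {ζ : ℂ} (h1 : 0 ≤ ζ.re) (h2 : ‖ζ‖ ≤ 1) : ζ ∈ closure HalfDisc := by
  have hconv : Convex ℝ HalfDisc := by
    refine Convex.inter ?_ (convex_ball 0 1)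
    exact convex_halfSpace_re_gt 0
  -- segment from 1/2
  have hlim : Tendsto (fun t : ℝ => (1 - t : ℂ) * ζ + (t : ℂ) * (1/2)) (𝓝[>] 0) (𝓝 ζ) := by
    have : Tendsto (fun t : ℝ => (1 - t : ℂ) * ζ + (t : ℂ) * (1/2)) (𝓝 0)
        (𝓝 ((1 - (0:ℝ) : ℂ) * ζ + ((0:ℝ) : ℂ) * (1/2))) := by
      apply Continuous.tendsto
      fun_prop
    simp only [Complex.ofReal_zero, sub_zero, one_mul, zero_mul, add_zero] at this
    exact this.mono_left nhdsWithin_le_nhds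
  refine mem_closure_of_tendsto hlim ?_
  have : Set.Ioo (0:ℝ) 1 ∈ 𝓝[>] (0:ℝ) := Ioo_mem_nhdsGT (by norm_num)
  filter_upwards [this] with t ht
  refine ⟨?_, ?_⟩
  · have : ((1 - t : ℂ) * ζ + (t : ℂ) * (1/2)).re = (1 - t) * ζ.re + t * (1/2) := by
      simp
    rw [Set.mem_ofPred_eq, this]
    have := mul_nonneg (sub_nonneg.2 ht.2.le) h1
    linarith [ht.1]
  · rw [mem_ball_zero_iff]
    calc _ ≤ ‖(1 - t : ℂ) * ζ‖ + ‖(t : ℂ) * (1/2)‖ := norm_add_le _ _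
      _ = (1 - t) * ‖ζ‖ + t * (1/2) := by
        rw [norm_mul, norm_mul]
        have : ‖(1 - t : ℂ)‖ = 1 - t := by
          rw [← Complex.ofReal_one, ← Complex.ofReal_sub, Complex.norm_real, Real.norm_eq_abs,
            abs_of_pos (by linarith [ht.2])]
        rw [this, Complex.norm_real, Real.norm_eq_abs, abs_of_pos ht.1]
        simp
      _ < 1 := by nlinarith [ht.1, ht.2]

lemma polar_cpow {r φ β : ℝ} (hr : 0 ≤ r) (hβ : 0 < β) (hφ : |φ| < Real.pi) :
    ((r : ℂ) * Complex.exp (φ * I)) ^ (β : ℂ) = ((r ^ β : ℝ) : ℂ) * Complex.exp ((β * φ : ℝ) * I) := by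
  rw [abs_lt] at hφ
  rcases hr.eq_or_lt with rfl | hr
  · rw [Real.zero_rpow hβ.ne']
    simp [hβ.ne']
  · have hne : (r : ℂ) * Complex.exp (φ * I) ≠ 0 :=
      mul_ne_zero (by exact_mod_cast hr.ne') (Complex.exp_ne_zero _)
    rw [Complex.cpow_def_of_ne_zero hne]
    have : Complex.log ((r : ℂ) * Complex.exp (φ * I)) = Real.log r + φ * I := by
      rw [Complex.log_ofReal_mul hr (Complex.exp_ne_zero _), Complex.log_exp]
      · simpa using hφ.1
      · simpa using hφ.2.le
    rw [this, Real.rpow_def_of_pos hr, Complex.ofReal_exp, ← Complex.exp_add]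
    congr 1
    push_cast; ring


lemma markov_aux {α : ℝ} (h0 : 0 < α) (h1 : α ≤ 1) {K A : ℝ} {n : ℕ} (hK : 1 < K)
    (P : Polynomial ℂ)
    (hP : ∀ w ∈ CSec α, ‖w‖ ≤ 1 → ‖P.eval w‖ ≤ A)
    (hP' : ∀ w : ℂ, ‖w‖ ≤ 1 → ‖P.eval w‖ ≤ A * K ^ n) {ζ : ℂ} (hζ : 0 ≤ ζ.re) (hζ1 : ‖ζ‖ ≤ 1) :
    ‖P.eval (-(ζ ^ ((2 - α : ℝ) : ℂ)))‖ ≤ A * Real.exp (3 * (n * Real.log K) * ‖ζ‖) := by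
  set β : ℝ := 2 - α with hβ
  have hβ0 : 0 < β := by linarith
  set N : ℝ := n * Real.log K with hN
  have hN0 : 0 ≤ N := mul_nonneg (Nat.cast_nonneg n) (Real.log_nonneg hK.le)
  have hA : 0 ≤ A := by
    have := hP 0 (by simp [CSec, rp]) (by simp)
    exact (norm_nonneg _).trans this
  have hKN : K ^ n = Real.exp N := by
    rw [hN, mul_comm, Real.exp_mul, Real.exp_log (by linarith), Real.rpow_natCast]
  set Q : ℂ → ℂ := fun ζ => P.eval (-(ζ ^ (β : ℂ))) * Complex.exp (-(N * (2 * ζ - ζ ^ 2))) with hQ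
  have hexp : ∀ ζ : ℂ, ‖Complex.exp (-(N * (2 * ζ - ζ ^ 2)))‖ =
      Real.exp (-(N * (2 * ζ.re - ζ.re ^ 2 + ζ.im ^ 2))) := by
    intro ζ
    rw [Complex.norm_exp]
    congr 1
    simp [pow_two]; left; ring
  have hnorm : ∀ ζ : ℂ, ‖-(ζ ^ (β : ℂ))‖ = ‖ζ‖ ^ β := by
    intro ζ
    rw [norm_neg]
    by_cases hz : ζ = 0
    · subst hz; simp [hβ0.ne', Real.zero_rpow hβ0.ne']
    · exact Complex.norm_cpow_real ζ β
  have hd : DiffContOnCl ℂ Q HalfDisc := by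
    have hcp : DiffContOnCl ℂ (fun ζ : ℂ => ζ ^ (β : ℂ)) HalfDisc := by
      constructor
      · intro ζ hζ
        have : ζ ∈ Complex.slitPlane := Or.inl hζ.1
        exact (DifferentiableAt.cpow_const differentiableAt_id this).differentiableWithinAt
      · intro ζ hζ
        obtain ⟨h1, h2⟩ := halfDisc_closure hζ
        by_cases hz : ζ = 0
        · subst hz
          exact (Complex.continuousAt_cpow_const_of_re_pos (Or.inl le_rfl)
            (by simpa using hβ0)).continuousWithinAt
        · refine (ContinuousAt.cpow continuousAt_id continuousAt_const ?_).continuousWithinAt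
          rcases h1.eq_or_lt with h | h
          · right
            intro him
            apply hz
            apply Complex.ext
            · exact h.symm
            · exact him
          · exact Or.inl h
    refine DiffContOnCl.smul (𝕜' := ℂ) ?_ ?_
    · exact P.differentiable.comp_diffContOnCl hcp.neg
    · apply Differentiable.diffContOnCl
      fun_prop
  have hfr : ∀ ζ ∈ frontier HalfDisc, ‖Q ζ‖ ≤ A := by
    intro ζ hζ
    have hcl : ζ ∈ closure HalfDisc := frontier_subset_closure hζ
    have hni : ζ ∉ HalfDisc := by
      rw [halfDisc_open.frontier_eq] at hζ
      exact hζ.2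
    obtain ⟨h1', h2⟩ := halfDisc_closure hcl
    have hle : ‖-(ζ ^ (β : ℂ))‖ ≤ 1 := by
      rw [hnorm]; exact Real.rpow_le_one (norm_nonneg _) h2 hβ0.le
    rw [hQ]
    simp only [norm_mul]
    rw [hexp]
    rcases h1'.eq_or_lt with h | h
    · -- imaginary axis
      have hmem : -(ζ ^ (β : ℂ)) ∈ CSec α := by
        have key : ∀ ε : ℝ, |ε| = 1 → ζ = ((‖ζ‖ : ℝ) : ℂ) * Complex.exp ((ε * (Real.pi / 2) : ℝ) * I) →
            -(ζ ^ (β : ℂ)) ∈ CSec α := by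
          intro ε hε hz
          rw [hz, polar_cpow (norm_nonneg _) hβ0 (by
            rw [abs_mul, hε, abs_of_pos (by positivity)]; linarith [Real.pi_pos])]
          have : -(((‖ζ‖ ^ β : ℝ) : ℂ) * Complex.exp ((β * (ε * (Real.pi / 2)) : ℝ) * I)) =
             ((‖ζ‖ ^ β : ℝ) : ℂ) * Complex.exp ((-ε * (α * Real.pi / 2) : ℝ) * I) := by
            rw [← mul_neg]
            congr 1
            have e1 : -(1 : ℂ) = Complex.exp ((-ε * Real.pi : ℝ) * I) := by
              rcases (abs_eq zero_le_one).1 hε with rfl | rfl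
              · simp [Complex.exp_neg]
              · simp
            rw [neg_eq_neg_one_mul, e1, ← Complex.exp_add]
            congr 1
            rw [hβ]; push_cast; ring
          rw [this]
          refine polar_mem_csec h0 h1 (by positivity) ?_
          rw [abs_mul, abs_neg, hε, one_mul, abs_of_nonneg]
          have := Real.pi_pos
          positivity
        have hzim : ζ = (ζ.im : ℂ) * I := by
          apply Complex.ext
          · simp [← h]
          · simp
        have hnz : ‖ζ‖ = |ζ.im| := by
          conv_lhs => rw [hzim]
          simp
        rcases le_total 0 ζ.im with him | him
        · apply key 1 (by simp)
          rw [hnz, abs_of_nonneg him]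
          conv_lhs => rw [hzim]
          congr 1
          simp [Complex.exp_pi_div_two_mul_I]
        · apply key (-1) (by simp)
          rw [hnz, abs_of_nonpos him]
          conv_lhs => rw [hzim]
          push_cast
          have e2 : (-1 * ((Real.pi : ℂ) / 2) * I : ℂ) = -((Real.pi : ℂ) / 2 * I) := by ring
          rw [e2, Complex.exp_neg, Complex.exp_pi_div_two_mul_I]
          simp
      have : Real.exp (-(N * (2 * ζ.re - ζ.re ^ 2 + ζ.im ^ 2))) ≤ 1 := by
        rw [Real.exp_le_one_iff, ← h]
        have : 0 ≤ N * ζ.im ^ 2 := by positivity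
        nlinarith
      calc _ ≤ A * 1 := by
            gcongr
            exact hP _ hmem hle
        _ = A := mul_one A
    · -- arc
      have hz1 : ‖ζ‖ = 1 := by
        refine le_antisymm h2 ?_
        by_contra hcon
        push Not at hcon
        exact hni ⟨h, by simpa using hcon⟩
      have hsq : ζ.re ^ 2 + ζ.im ^ 2 = 1 := by
        have := Complex.sq_norm ζ
        rw [hz1, Complex.normSq_apply] at this
        nlinarith
      have hx1 : ζ.re ≤ 1 := by nlinarith [sq_nonneg ζ.im]
      calc _ ≤ (A * K ^ n) * Real.exp (-N) := by
            gcongr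
            · exact hP' _ hle
            · have : 1 ≤ 2 * ζ.re - ζ.re ^ 2 + ζ.im ^ 2 := by nlinarith
              nlinarith
        _ = A := by rw [hKN, mul_assoc, ← Real.exp_add]; simp
  have hb : Bornology.IsBounded HalfDisc :=
    Metric.isBounded_ball.subset Set.inter_subset_right
  have hmain : ‖Q ζ‖ ≤ A := Complex.norm_le_of_forall_mem_frontier_norm_le hb hd hfr
    (halfDisc_closure' hζ hζ1)
  rw [hQ] at hmain
  simp only [norm_mul] at hmain
  rw [hexp] at hmain
  set E := N * (2 * ζ.re - ζ.re ^ 2 + ζ.im ^ 2) with hE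
  have hE1 : E ≤ 3 * N * ‖ζ‖ := by
    have a1 : ζ.re ≤ ‖ζ‖ := Complex.re_le_norm ζ
    have a2 := Complex.sq_norm ζ
    rw [Complex.normSq_apply] at a2
    have a3 : 2 * ζ.re - ζ.re ^ 2 + ζ.im ^ 2 ≤ 3 * ‖ζ‖ := by
      nlinarith [norm_nonneg ζ, sq_nonneg ζ.re]
    calc E ≤ N * (3 * ‖ζ‖) := by rw [hE]; gcongr
      _ = _ := by ring
  calc ‖P.eval (-(ζ ^ (β : ℂ)))‖ = ‖P.eval (-(ζ ^ (β : ℂ)))‖ * Real.exp (-E) * Real.exp E := by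
        rw [mul_assoc, ← Real.exp_add]; simp
    _ ≤ A * Real.exp (3 * N * ‖ζ‖) := by gcongr

lemma markov_growth {α : ℝ} (h0 : 0 < α) (h1 : α ≤ 1) {K A : ℝ} {n : ℕ} (hK : 1 < K)
    (P : Polynomial ℂ)
    (hP : ∀ w ∈ CSec α, ‖w‖ ≤ 1 → ‖P.eval w‖ ≤ A)
    (hP' : ∀ w : ℂ, ‖w‖ ≤ 1 → ‖P.eval w‖ ≤ A * K ^ n) {w : ℂ} (hw : ‖w‖ ≤ 1) :
    ‖P.eval w‖ ≤ A * Real.exp (3 * (n * Real.log K) * ‖w‖ ^ (1 / (2 - α))) := by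
  have hβ0 : 0 < 2 - α := by linarith
  have hN0 : 0 ≤ n * Real.log K := mul_nonneg (Nat.cast_nonneg n) (Real.log_nonneg hK.le)
  have hA : 0 ≤ A := by
    have := hP 0 (by simp [CSec, rp]) (by simp)
    exact (norm_nonneg _).trans this
  have hpi := Real.pi_pos
  set θ := (-w).arg with hθ
  have hwp : -w = ((‖w‖ : ℝ) : ℂ) * Complex.exp (θ * I) := by
    rw [← norm_neg w, hθ, Complex.norm_mul_exp_arg_mul_I]
  have hθ1 := Complex.neg_pi_lt_arg (-w)
  have hθ2 := Complex.arg_le_pi (-w)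
  rw [← hθ] at hθ1 hθ2
  by_cases hc : |θ| ≤ (2 - α) * Real.pi / 2
  · set r : ℝ := ‖w‖ ^ (1 / (2 - α)) with hr
    have hr0 : 0 ≤ r := by positivity
    set φ : ℝ := θ / (2 - α) with hφ
    have hφ1 : |φ| ≤ Real.pi / 2 := by
      rw [hφ, abs_div, abs_of_pos hβ0, div_le_iff₀ hβ0]
      linarith
    set ζ : ℂ := (r : ℂ) * Complex.exp (φ * I) with hζ
    have hζn : ‖ζ‖ = r := by
      rw [hζ, norm_mul, Complex.norm_exp_ofReal_mul_I, Complex.norm_real, Real.norm_eq_abs,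
        abs_of_nonneg hr0, mul_one]
    have hζre : 0 ≤ ζ.re := by
      rw [hζ, Complex.re_ofReal_mul, Complex.exp_ofReal_mul_I_re]
      exact mul_nonneg hr0 (Real.cos_nonneg_of_mem_Icc (abs_le.1 hφ1))
    have hζp : ζ ^ ((2 - α : ℝ) : ℂ) = -w := by
      rw [hζ, polar_cpow hr0 hβ0 (by linarith), hwp]
      congr 2
      · rw [hr, ← Real.rpow_mul (norm_nonneg _), one_div, inv_mul_cancel₀ hβ0.ne', Real.rpow_one]
      · rw [hφ]; congr 2; field_simp
    have := markov_aux h0 h1 hK P hP hP' hζre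
      (by rw [hζn, hr]; exact Real.rpow_le_one (norm_nonneg _) hw (by positivity))
    rw [hζp, neg_neg, hζn] at this
    exact this
  · have hmem : w ∈ CSec α := by
      push Not at hc
      have key : ∀ ε : ℝ, |ε| = 1 → |θ - ε * Real.pi| ≤ α * Real.pi / 2 → w ∈ CSec α := by
        intro ε hε hh
        have : w = ((‖w‖ : ℝ) : ℂ) * Complex.exp ((θ - ε * Real.pi : ℝ) * I) := by
          have e1 : -(1 : ℂ) = Complex.exp ((-ε * Real.pi : ℝ) * I) := by
            rcases (abs_eq zero_le_one).1 hε with rfl | rfl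
            · simp [Complex.exp_neg]
            · simp
          calc w = -(1:ℂ) * -w := by ring
            _ = _ := by
              rw [hwp, e1, mul_left_comm, ← Complex.exp_add]
              congr 2
              push_cast; ring
        rw [this]
        exact polar_mem_csec h0 h1 (norm_nonneg _) hh
      rcases lt_abs.1 hc with h | h
      · apply key 1 (by simp)
        rw [abs_le]; constructor <;> linarith
      · apply key (-1) (by simp)
        rw [abs_le]; constructor <;> linarith
    refine (hP w hmem hw).trans (le_mul_of_one_le_right hA ?_)
    rw [Real.one_le_exp_iff]
    positivity

lemma markov {α : ℝ} (h0 : 0 < α) (h1 : α ≤ 1) : ∃ e : ℝ, 0 < e ∧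
    ∀ (n k : ℕ) (P : Polynomial ℂ) (A : ℝ), 1 ≤ k → k ≤ n → P.natDegree ≤ n → 
      (∀ w ∈ CSec α, ‖w‖ ≤ 1 → ‖P.eval w‖ ≤ A) →
      ‖P.coeff k‖ ≤ A * Real.exp (k * (e + (2 - α) * Real.log (n / k))) := by
  obtain ⟨K, hK, hcr⟩ := poly_crude h0 h1
  refine ⟨3 * Real.log K, by have := Real.log_pos hK; positivity, ?_⟩
  intro n k P A hk hkn hdeg hP
  have hβ0 : 0 < 2 - α := by linarith
  have hk0 : (0:ℝ) < k := by exact_mod_cast hk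
  have hn0 : (0:ℝ) < n := by exact_mod_cast (hk.trans hkn)
  have hkn' : (k:ℝ) / n ≤ 1 := by rw [div_le_one hn0]; exact_mod_cast hkn
  set s : ℝ := ((k:ℝ) / n) ^ (2 - α) with hs
  have hs0 : 0 < s := by positivity
  have hs1 : s ≤ 1 := Real.rpow_le_one (by positivity) hkn' hβ0.le
  have hsr : s ^ (1 / (2 - α)) = k / n := by
    rw [hs, ← Real.rpow_mul (by positivity), one_div, mul_inv_cancel₀ hβ0.ne', Real.rpow_one]
  have := poly_coeff_le P hs0 (A := A * Real.exp (3 * (n * Real.log K) * (k / n))) (by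
    intro w hw
    have := markov_growth h0 h1 hK P hP (hcr n P A (hk.trans hkn) hdeg hP) (w := w) (by rw [hw]; exact hs1)
    rwa [hw, hsr] at this) k
  refine this.trans (le_of_eq ?_)
  have hsl : s = Real.exp (-(2 - α) * Real.log (n / k)) := by
    rw [hs, Real.rpow_def_of_pos (by positivity), ← inv_div (n:ℝ) k, Real.log_inv]
    congr 1; ring
  rw [hsl, ← Real.exp_nat_mul, mul_div_assoc, ← Real.exp_sub]
  congr 2
  field_simp
  ring

end UH

namespace UH

lemma taylor_bound (n : ℕ) : ∀ (G : ℕ → ℝ → ℂ) (B : ℝ),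
    (∀ i, ∀ t ∈ Set.Icc (0:ℝ) 1, HasDerivAt (G i) (G (i+1) t) t) →
    (∀ t ∈ Set.Icc (0:ℝ) 1, ‖G n t‖ ≤ B) → ∀ t ∈ Set.Icc (0:ℝ) 1,
    ‖G 0 t - ∑ i ∈ Finset.range n, G i 0 * ((t ^ i / i.factorial : ℝ) : ℂ)‖
      ≤ B * (t ^ n / n.factorial) := by
  induction n with
  | zero => intro G B _ hB t ht; simpa using hB t ht
  | succ n ih =>
    intro G B hG hB
    have h1 := ih (fun i => G (i+1)) B (fun i t ht => hG (i+1) t ht) hB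
    have hpow : ∀ (i : ℕ) (t : ℝ), HasDerivAt (fun t : ℝ => t ^ (i+1) / ((i+1).factorial : ℝ))
        (t ^ i / (i.factorial : ℝ)) t := by
      intro i t
      have := (hasDerivAt_pow (i+1) t).div_const ((i+1).factorial : ℝ)
      refine this.congr_deriv ?_
      rw [Nat.factorial_succ]
      have : (i.factorial : ℝ) ≠ 0 := by exact_mod_cast Nat.factorial_ne_zero i
      push_cast
      have h2 : (i : ℝ) + 1 ≠ 0 := by positivity
      field_simp
    have hd : ∀ t ∈ Set.Icc (0:ℝ) 1, HasDerivAt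
        (fun t : ℝ => G 0 t - ∑ i ∈ Finset.range (n+1), G i 0 * ((t ^ i / i.factorial : ℝ) : ℂ))
        (G 1 t - ∑ i ∈ Finset.range n, G (i+1) 0 * ((t ^ i / i.factorial : ℝ) : ℂ)) t := by
      intro t ht
      refine (hG 0 t ht).sub ?_
      simp only [Finset.sum_range_succ']
      have : HasDerivAt (fun t : ℝ => ∑ i ∈ Finset.range n,
          G (i+1) 0 * ((t ^ (i+1) / (i+1).factorial : ℝ) : ℂ))
          (∑ i ∈ Finset.range n, G (i+1) 0 * ((t ^ i / i.factorial : ℝ) : ℂ)) t := by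
        apply HasDerivAt.fun_sum
        intro i _
        exact (hpow i t).ofReal_comp.const_mul _
      simpa using this.add_const (G 0 0)
    refine image_norm_le_of_norm_deriv_right_le_deriv_boundary
      (f' := fun t => G 1 t - ∑ i ∈ Finset.range n, G (i+1) 0 * ((t ^ i / i.factorial : ℝ) : ℂ))
      (B' := fun t => B * (t ^ n / n.factorial)) ?_ ?_ ?_ ?_ ?_
    · intro t ht
      exact (hd t ht).continuousAt.continuousWithinAt
    · intro t ht
      exact (hd t ⟨ht.1, ht.2.le⟩).hasDerivWithinAt
    · simp [Finset.sum_range_succ']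
    · intro t
      exact (hpow n t).const_mul B
    · intro t ht
      exact h1 t ⟨ht.1, ht.2.le⟩

lemma log_fact_le (k : ℕ) : Real.log k.factorial ≤ k * Real.log k := by
  rcases Nat.eq_zero_or_pos k with rfl | hk
  · simp
  · rw [← Real.log_pow]
    apply Real.log_le_log (by exact_mod_cast Nat.factorial_pos k)
    exact_mod_cast Nat.factorial_le_pow k

lemma le_log_fact (n : ℕ) : n * Real.log n - n ≤ Real.log n.factorial := by
  rcases Nat.eq_zero_or_pos n with rfl | hn
  · simp
  · have hn0 : (0:ℝ) < n := by exact_mod_cast hn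
    have hf : (0:ℝ) < n.factorial := by exact_mod_cast Nat.factorial_pos n
    have h1 := Real.pow_div_factorial_le_exp (n:ℝ) hn0.le n
    have h2 := Real.log_le_log (by positivity) h1
    rw [Real.log_div (by positivity) hf.ne', Real.log_pow, Real.log_exp] at h2
    linarith

lemma landau {α : ℝ} (h0 : 0 < α) (h1 : α ≤ 1) : ∃ e : ℝ, 0 < e ∧
    ∀ (G : ℕ → ℂ → ℂ), (∀ i, ∀ z ∈ Sector α, HasDerivAt (G i) (G (i+1) z) z) →
    ∀ (n k : ℕ) (a b : ℝ), 1 ≤ k → k < n → (∀ z ∈ Sector α, ‖G 0 z‖ ≤ Real.exp a) →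
    (∀ z ∈ Sector α, ‖G n z‖ ≤ Real.exp b) → ∀ z ∈ Sector α,
    ‖G k z‖ ≤ Real.exp (k * (e + (1 - α) * Real.log (n / k)) + (1 - k / n) * a + k / n * b) := by
  obtain ⟨e, he, hmar⟩ := markov h0 h1
  refine ⟨e + 2, by linarith, ?_⟩
  intro G hG n k a b hk hkn ha hb z hz
  have hk0 : (0:ℝ) < k := by exact_mod_cast hk
  have hk1 : (1:ℝ) ≤ k := by exact_mod_cast hk
  have hn0 : (0:ℝ) < n := by exact_mod_cast (hk.trans hkn.le)
  have hf : (0:ℝ) < n.factorial := by exact_mod_cast Nat.factorial_pos n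
  have hfk : (0:ℝ) < k.factorial := by exact_mod_cast Nat.factorial_pos k
  set x : ℝ := (a - b + Real.log n.factorial) / n with hx
  set r : ℝ := Real.exp x with hr
  have hr0 : 0 < r := Real.exp_pos _
  have hrn : Real.exp b * (r ^ n / n.factorial) = Real.exp a := by
    have : (n.factorial : ℝ) = Real.exp (Real.log n.factorial) := (Real.exp_log hf).symm
    rw [this, hr, ← Real.exp_nat_mul, ← Real.exp_sub, ← Real.exp_add]
    congr 1
    rw [hx]; field_simp; ring
  set P : Polynomial ℂ := ∑ i ∈ Finset.range n,
    Polynomial.C (G i z * ((r ^ i / i.factorial : ℝ) : ℂ)) * Polynomial.X ^ i with hP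
  have hPe : ∀ w, P.eval w = ∑ i ∈ Finset.range n, G i z * ((r ^ i / i.factorial : ℝ) : ℂ) * w ^ i := by
    intro w; simp [hP, Polynomial.eval_finsetSum]
  have hPd : P.natDegree ≤ n := by
    refine Polynomial.natDegree_sum_le_of_forall_le _ _ fun i hi => ?_
    exact (Polynomial.natDegree_C_mul_X_pow_le _ _).trans (Finset.mem_range.1 hi).le
  have hPc : P.coeff k = G k z * ((r ^ k / k.factorial : ℝ) : ℂ) := by
    rw [hP, Polynomial.finsetSum_coeff]
    simp only [Polynomial.coeff_C_mul_X_pow]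
    rw [Finset.sum_ite_eq (Finset.range n) k]
    simp [hkn]
  have hbd : ∀ w ∈ CSec α, ‖w‖ ≤ 1 → ‖P.eval w‖ ≤ 2 * Real.exp a := by
    intro w hw hw1
    set v : ℂ := (r : ℂ) * w with hv
    have hvn : ‖v‖ ≤ r := by
      rw [hv, norm_mul, Complex.norm_real, Real.norm_eq_abs, abs_of_pos hr0]
      exact mul_le_of_le_one_right hr0.le hw1
    have hseg : ∀ t ∈ Set.Icc (0:ℝ) 1, z + (t : ℂ) * v ∈ Sector α := by
      intro t ht
      exact sector_add h0 h1 hz (csec_smul ht.1 (csec_smul hr0.le hw))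
    have ht := taylor_bound n (fun i t => G i (z + (t:ℂ) * v) * v ^ i) (Real.exp b * r ^ n) (by
      intro i t ht
      have e1 : HasDerivAt (fun t : ℝ => z + (t:ℂ) * v) (1 * v) t :=
        ((hasDerivAt_id t).ofReal_comp.mul_const v).const_add z
      have e2 := ((hG i _ (hseg t ht)).comp t e1).mul_const (v ^ i)
      refine e2.congr_deriv ?_
      ring) (by
      intro t ht
      rw [norm_mul, norm_pow]
      gcongr
      exact hb _ (hseg t ht)) 1 (by simp)
    simp only [one_pow, pow_zero, mul_one, Complex.ofReal_one, one_mul, Complex.ofReal_zero,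
      zero_mul, add_zero] at ht
    have e3 : ∑ i ∈ Finset.range n, G i z * v ^ i * ((1 / i.factorial : ℝ) : ℂ) = P.eval w := by
      rw [hPe]
      refine Finset.sum_congr rfl fun i _ => ?_
      rw [hv, mul_pow]; push_cast; ring
    rw [e3] at ht
    have e4 : Real.exp b * r ^ n * (1 / n.factorial) = Real.exp a := by
      rw [← hrn]; ring
    rw [e4] at ht
    have e5 : ‖G 0 (z + v)‖ ≤ Real.exp a := by
      have := hseg 1 (by simp)
      simp only [Complex.ofReal_one, one_mul] at this
      exact ha _ this
    calc ‖P.eval w‖ = ‖G 0 (z+v) - (G 0 (z+v) - P.eval w)‖ := by congr 1; ring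
      _ ≤ _ := norm_sub_le _ _
      _ ≤ 2 * Real.exp a := by linarith
  have := hmar n k P _ hk hkn.le hPd hbd
  rw [hPc, norm_mul, Complex.norm_real, Real.norm_eq_abs, abs_of_pos (by positivity)] at this
  have h2 : ‖G k z‖ ≤ (k.factorial / r ^ k) *
      (2 * Real.exp a * Real.exp (k * (e + (2 - α) * Real.log (n / k)))) := by
    calc ‖G k z‖ = (k.factorial / r ^ k) * (‖G k z‖ * (r ^ k / k.factorial)) := by
          field_simp
      _ ≤ _ := by gcongr
  refine h2.trans ?_
  have e1 : (k.factorial : ℝ) / r ^ k = Real.exp (Real.log k.factorial - k * x) := by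
    rw [Real.exp_sub, Real.exp_log hfk, hr, ← Real.exp_nat_mul]
  have e2 : (2:ℝ) = Real.exp (Real.log 2) := (Real.exp_log (by norm_num)).symm
  have e6 : (2:ℝ) * Real.exp a = Real.exp (Real.log 2 + a) := by
    rw [Real.exp_add, ← e2]
  rw [e1, e6, ← Real.exp_add, ← Real.exp_add]
  apply Real.exp_le_exp.2
  have l2 : Real.log 2 ≤ k := by linarith [Real.log_two_lt_d9]
  have lk := log_fact_le k
  have ln := le_log_fact n
  rw [Real.log_div hn0.ne' hk0.ne']
  have e7 : k * x = k / n * (a - b) + k / n * Real.log n.factorial := by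
    rw [hx]; field_simp
  have e8 : (k:ℝ) / n * (n * Real.log n - n) ≤ k / n * Real.log n.factorial := by gcongr
  have e9 : (k:ℝ) / n * (n * Real.log n - n) = k * Real.log n - k := by field_simp
  rw [e7]
  nlinarith

lemma gap {l k n : ℕ} (hlk : l < k) (hkn : k < n) :
    ((n:ℝ) - l) * (((k:ℝ) - l) * Real.log (((n:ℝ) - l) / (k - l)) + k * Real.log k - k) ≤
      ((k:ℝ) - l) * (n * Real.log n) + ((n:ℝ) - k) * (l * Real.log l) := by
  have hl0 : (0:ℝ) ≤ l := Nat.cast_nonneg l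
  have hlk' : (l:ℝ) < k := by exact_mod_cast hlk
  have hkn' : (k:ℝ) < n := by exact_mod_cast hkn
  have hkl : (0:ℝ) < k - l := by linarith
  have hnl : (0:ℝ) < n - l := by linarith
  have hk0 : (0:ℝ) < k := by linarith
  have hn0 : (0:ℝ) < n := by linarith
  rw [Real.log_div hnl.ne' hkl.ne']
  have f1 : Real.log ((n:ℝ) - l) ≤ Real.log n := Real.log_le_log hnl (by linarith)
  have f2 : Real.log (k:ℝ) ≤ Real.log n := Real.log_le_log hk0 hkn'.le
  have f3 : ((k:ℝ) - l) * (Real.log k - Real.log (k - l)) ≤ l := by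
    have := Real.log_le_sub_one_of_pos (x := (k:ℝ) / (k - l)) (by positivity)
    rw [Real.log_div hk0.ne' hkl.ne'] at this
    calc _ ≤ ((k:ℝ) - l) * (k / (k - l) - 1) := by gcongr
      _ = l := by field_simp; ring
  have f4 : (l:ℝ) * (Real.log k - Real.log l) ≤ k - l := by
    rcases hl0.eq_or_lt with h | h
    · rw [← h]; simp
    · have := Real.log_le_sub_one_of_pos (x := (k:ℝ) / l) (by positivity)
      rw [Real.log_div hk0.ne' h.ne'] at this
      calc _ ≤ (l:ℝ) * (k / l - 1) := by gcongr
        _ = k - l := by field_simp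
  set A := Real.log (n:ℝ)
  set B := Real.log (k:ℝ)
  set Cc := Real.log (l:ℝ)
  set D := Real.log ((n:ℝ) - l)
  set E := Real.log ((k:ℝ) - l)
  have g1 : ((k:ℝ) - l) * (D - E) ≤ (k - l) * (A - B) + l := by nlinarith
  have g2 : ((n:ℝ) - l) * ((k - l) * (D - E)) ≤ (n - l) * ((k - l) * (A - B) + l) := by gcongr
  have g3 : 0 ≤ (l:ℝ) * ((k - l) * (A - B)) :=
    mul_nonneg hl0 (mul_nonneg hkl.le (by linarith))
  have g4 : ((n:ℝ) - k) * (l * (B - Cc)) ≤ (n - k) * (k - l) := by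
    apply mul_le_mul_of_nonneg_left f4; linarith
  have g5 : ((n:ℝ) - k) * (k - l) ≤ (n - l) * (k - l) := by
    apply mul_le_mul_of_nonneg_right _ hkl.le; linarith
  nlinarith

lemma Gbar_eq (s : ℝ) (j : ℕ) : Gbar s j = Real.exp (s * (j * Real.log j)) := by
  unfold Gbar
  rcases Nat.eq_zero_or_pos j with rfl | hj
  · simp
  · rw [Real.rpow_def_of_pos (by exact_mod_cast hj)]
    congr 1; ring

lemma Gbar_pos (s : ℝ) (j : ℕ) : 0 < Gbar s j := by rw [Gbar_eq]; exact Real.exp_pos _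

lemma regularize {α : ℝ} (h0 : 0 < α) (h1 : α ≤ 1) (G : ℕ → ℂ → ℂ)
    (hG : ∀ i, ∀ z ∈ Sector α, HasDerivAt (G i) (G (i+1) z) z) (M L : ℕ → ℝ) (hM : ∀ j, 0 < M j)
    (hL : IsLcMinorant (fun j => Gbar (1 - α) j * M j) L) (C h : ℝ) (hC : 0 < C) (hh : 0 < h)
    (hb : ∀ j, ∀ z ∈ Sector α, ‖G j z‖ ≤ C * h ^ j * M j) :
    ∃ C' > 0, ∃ h' > 0, ∀ j, ∀ z ∈ Sector α, ‖G j z‖ ≤ C' * h' ^ j * (Gbar (α - 1) j * L j) := by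
  obtain ⟨e, he, hlan⟩ := landau h0 h1
  obtain ⟨hLpos, hLc, hLle, hLmax⟩ := hL
  refine ⟨C * (1 + M 0 / L 0), mul_pos hC (by have := hM 0; have := hLpos 0; positivity),
    h * Real.exp (e + 1), by positivity, ?_⟩
  intro k z hz
  rcases Nat.eq_zero_or_pos k with rfl | hk
  · have := hb 0 z hz
    have hl0 := hLpos 0
    have hm0 := hM 0
    rw [Gbar_eq]
    simp only [pow_zero, mul_one, CharP.cast_eq_zero, zero_mul, mul_zero, Real.exp_zero, one_mul] at *
    refine this.trans ?_
    rw [mul_assoc, add_mul, div_mul_cancel₀ _ hl0.ne']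
    nlinarith
  by_cases hzero : G k z = 0
  · rw [hzero, norm_zero]
    have := hLpos k
    have := Gbar_pos (α - 1) k
    have := hM 0; have := hLpos 0
    positivity
  have hnp : 0 < ‖G k z‖ := norm_pos_iff.2 hzero
  have hk0 : (0:ℝ) < k := by exact_mod_cast hk
  -- bounds in exponential form
  have hbe : ∀ j, C * h ^ j * M j = Real.exp (Real.log C + j * Real.log h + Real.log (M j)) := by
    intro j
    rw [Real.exp_add, Real.exp_add, Real.exp_log hC, Real.exp_log (hM j), Real.exp_nat_mul,
      Real.exp_log hh]
  set A : ℕ → ℝ := fun j => (1 - α) * (j * Real.log j) + Real.log (M j) with hA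
  have hAe : ∀ j, Gbar (1 - α) j * M j = Real.exp (A j) := by
    intro j
    rw [Gbar_eq, hA, Real.exp_add, Real.exp_log (hM j)]
  set B : ℝ := Real.log ‖G k z‖ + (1 - α) * (k * Real.log k) - Real.log C - k * Real.log h
    - k * (e + 1) with hB
  have hBk : B ≤ A k := by
    have := Real.log_le_log hnp (hb k z hz)
    rw [hbe, Real.log_exp] at this
    have : 0 ≤ k * (e + 1) := by positivity
    simp only [hA, hB]; linarith
  have hBln : ∀ l n : ℕ, l < k → k < n →
      ((n:ℝ) - l) * B ≤ ((n:ℝ) - k) * A l + ((k:ℝ) - l) * A n := by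
    intro l n hl hn
    have hl' : (l:ℝ) < k := by exact_mod_cast hl
    have hn' : (k:ℝ) < n := by exact_mod_cast hn
    have hl0 : (0:ℝ) ≤ l := Nat.cast_nonneg l
    have hnl : (0:ℝ) < n - l := by linarith
    have := hlan (fun i => G (i + l)) (fun i z hz => by
      have := hG (i + l) z hz
      rwa [show i + 1 + l = i + l + 1 by ring]) (n - l) (k - l) _ _ (by omega) (by omega)
      (fun z hz => by
        show ‖G (0 + l) z‖ ≤ _
        rw [zero_add]
        have := hb l z hz
        rwa [hbe] at this)
      (fun z hz => by
        show ‖G (n - l + l) z‖ ≤ _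
        rw [Nat.sub_add_cancel (hl.trans hn).le]
        have := hb n z hz
        rwa [hbe] at this) z hz
    have e0 : k - l + l = k := by omega
    simp only [e0] at this
    have h2 := Real.log_le_log hnp this
    rw [Real.log_exp, Nat.cast_sub hl.le, Nat.cast_sub (hl.trans hn).le] at h2
    have h3 := gap hl hn
    set G1 := Real.log (((n:ℝ) - l) / (k - l))
    have h4 : ((n:ℝ) - l) * Real.log ‖G k z‖ ≤ ((n:ℝ) - l) * (((k:ℝ) - l) * (e + (1 - α) * G1)) +
       ((n:ℝ) - k) * (Real.log C + l * Real.log h + Real.log (M l)) + 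
       ((k:ℝ) - l) * (Real.log C + n * Real.log h + Real.log (M n)) := by
      calc _ ≤ _ := mul_le_mul_of_nonneg_left h2 hnl.le
        _ = _ := by field_simp; ring
    have hσ : 0 ≤ 1 - α := by linarith
    have h5 := mul_le_mul_of_nonneg_left h3 hσ
    have h6 : ((n:ℝ) - l) * ((k - l) * e) ≤ (n - l) * (k * e) := by
      gcongr; linarith
    have h7 : ((n:ℝ) - l) * ((1 - α) * k) ≤ (n - l) * k := by
      apply mul_le_mul_of_nonneg_left _ hnl.le
      nlinarith
    simp only [hA, hB]
    nlinarith
  -- supporting line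
  have hne : (Finset.range k).Nonempty := ⟨0, Finset.mem_range.2 hk⟩
  set τ := (Finset.range k).sup' hne (fun l => (B - A l) / ((k:ℝ) - l)) with hτ
  have hline : ∀ j : ℕ, B + ((j:ℝ) - k) * τ ≤ A j := by
    intro j
    rcases lt_trichotomy j k with hj | hj | hj
    · have hj' : (j:ℝ) < k := by exact_mod_cast hj
      have : (B - A j) / ((k:ℝ) - j) ≤ τ :=
        Finset.le_sup' (f := fun l : ℕ => (B - A l) / ((k:ℝ) - l)) (Finset.mem_range.2 hj)
      rw [div_le_iff₀ (by linarith)] at this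
      linarith
    · subst hj; simpa using hBk
    · have hj' : (k:ℝ) < j := by exact_mod_cast hj
      obtain ⟨l, hl, hle⟩ := Finset.exists_mem_eq_sup' hne (fun l : ℕ => (B - A l) / ((k:ℝ) - l))
      have hl := Finset.mem_range.1 hl
      have hl' : (l:ℝ) < k := by exact_mod_cast hl
      have h3 := hBln l j hl hj
      have hkl : (0:ℝ) < k - l := by linarith
      have hτl : τ * (k - l) = B - A l := by
        rw [hτ, hle]; field_simp
      have : ((k:ℝ) - l) * (B + (j - k) * τ) ≤ (k - l) * A j := by
        have : ((k:ℝ) - l) * (B + (j - k) * τ) = (k - l) * B + (j - k) * (τ * (k - l)) := by ring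
        rw [this, hτl]
        linarith
      exact le_of_mul_le_mul_left this hkl
  have hfin := hLmax (fun j => Real.exp (B + ((j:ℝ) - k) * τ)) (fun j => Real.exp_pos _) (by
    intro j
    show Real.exp _ ^ 2 ≤ Real.exp _ * Real.exp _
    rw [← Real.exp_nat_mul, ← Real.exp_add]
    apply Real.exp_le_exp.2
    push_cast
    apply le_of_eq
    ring) (fun j => by
      show Real.exp _ ≤ Gbar (1 - α) j * M j
      rw [hAe]
      exact Real.exp_le_exp.2 (hline j)) k
  simp only [sub_self, zero_mul, add_zero] at hfin
  have hexpand : ‖G k z‖ = C * (h * Real.exp (e + 1)) ^ k * (Gbar (α - 1) k * Real.exp B) := by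
    rw [Gbar_eq, mul_pow, ← Real.exp_nat_mul]
    have e1 : h ^ k = Real.exp (k * Real.log h) := by rw [Real.exp_nat_mul, Real.exp_log hh]
    have e2 : C = Real.exp (Real.log C) := (Real.exp_log hC).symm
    conv_lhs => rw [← Real.exp_log hnp]
    conv_rhs => rw [e2, e1]
    rw [← Real.exp_add, ← Real.exp_add, ← Real.exp_add, ← Real.exp_add]
    congr 1
    simp only [hB]; ring
  have hq := Gbar_pos (α - 1) k
  have hl0 := hLpos 0
  have hm0 := hM 0
  have hlk := hLpos k
  calc ‖G k z‖ = C * (h * Real.exp (e + 1)) ^ k * (Gbar (α - 1) k * Real.exp B) := hexpand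
    _ ≤ C * (h * Real.exp (e + 1)) ^ k * (Gbar (α - 1) k * L k) := by gcongr
    _ ≤ _ := by
      gcongr
      apply le_mul_of_one_le_right hC.le
      have : 0 ≤ M 0 / L 0 := by positivity
      linarith

end UH

namespace UH

lemma hasDerivAt_iD {U : Set ℂ} (hU : IsOpen U) {f : ℂ → ℂ} (hf : DifferentiableOn ℂ f U) (i : ℕ)
    {z : ℂ} (hz : z ∈ U) : HasDerivAt (iteratedDeriv i f) (iteratedDeriv (i+1) f z) z := by
  have ha : AnalyticAt ℂ f z := hf.analyticAt (hU.mem_nhds hz)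
  have hb : AnalyticAt ℂ (iteratedDeriv i f) z := by
    rw [iteratedDeriv_eq_iterate]; exact ha.iterated_deriv i
  rw [iteratedDeriv_succ]
  exact hb.differentiableAt.hasDerivAt

lemma Gbar_cancel (α : ℝ) (j : ℕ) : Gbar (α - 1) j * Gbar (1 - α) j = 1 := by
  rw [Gbar_eq, Gbar_eq, ← Real.exp_add]
  rw [show (α - 1) * (j * Real.log j) + (1 - α) * (j * Real.log j) = 0 by ring, Real.exp_zero]

lemma N_le_M {α : ℝ} {M L : ℕ → ℝ} (hL : IsLcMinorant (fun j => Gbar (1-α) j * M j) L) (j : ℕ) :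
    Gbar (α - 1) j * L j ≤ M j := by
  calc Gbar (α - 1) j * L j ≤ Gbar (α - 1) j * (Gbar (1-α) j * M j) :=
        mul_le_mul_of_nonneg_left (hL.2.2.1 j) (Gbar_pos _ _).le
    _ = M j := by rw [← mul_assoc, Gbar_cancel, one_mul]

lemma reg_of_mem {α : ℝ} (h0 : 0 < α) (h1 : α ≤ 1) {M L : ℕ → ℝ} (hM : ∀ j, 0 < M j)
    (hL : IsLcMinorant (fun j => Gbar (1-α) j * M j) L) {f : ℂ → ℂ} (hf : f ∈ ASet M α) :
    ∃ C > 0, ∃ h > 0, ∀ j, ∀ z ∈ Sector α,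
      ‖iteratedDeriv j f z‖ ≤ C * h ^ j * (Gbar (α-1) j * L j) := by
  obtain ⟨hd, h, hh, C, hC⟩ := hf
  refine regularize h0 h1 (fun i => iteratedDeriv i f)
    (fun i z hz => hasDerivAt_iD (sector_open h0 h1) hd i hz) M L hM hL (|C| + 1) h
    (by positivity) hh ?_
  intro j z hz
  rw [← iteratedDerivWithin_of_isOpen (sector_open h0 h1) hz]
  refine (hC j z hz).trans ?_
  have := hM j
  gcongr
  linarith [le_abs_self C]

lemma mem_of_bound {α : ℝ} (h0 : 0 < α) (h1 : α ≤ 1) {M : ℕ → ℝ} {f : ℂ → ℂ}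
    (hd : DifferentiableOn ℂ f (Sector α)) {C h : ℝ} (hh : 0 < h)
    (hb : ∀ j, ∀ z ∈ Sector α, ‖iteratedDeriv j f z‖ ≤ C * h ^ j * M j) : f ∈ ASet M α := by
  refine ⟨hd, h, hh, C, fun j z hz => ?_⟩
  rw [iteratedDerivWithin_of_isOpen (sector_open h0 h1) hz]
  exact hb j z hz

lemma jet_comp (k : ℕ) : ∀ (g φ ψ : ℂ → ℂ) (a : ℂ), AnalyticAt ℂ φ a → AnalyticAt ℂ ψ a →
    AnalyticAt ℂ g (φ a) → (∀ i ≤ k, iteratedDeriv i φ a = iteratedDeriv i ψ a) →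
    iteratedDeriv k (fun w => g (φ w)) a = iteratedDeriv k (fun w => g (ψ w)) a := by
  induction k using Nat.strong_induction_on with
  | _ k ih =>
    intro g φ ψ a hφ hψ hg hj
    have h00 : φ a = ψ a := by simpa using hj 0 (Nat.zero_le _)
    rcases k with _ | k
    · simp [h00]
    · have key : ∀ χ : ℂ → ℂ, AnalyticAt ℂ χ a → AnalyticAt ℂ g (χ a) →
          iteratedDeriv (k+1) (fun w => g (χ w)) a = ∑ i ∈ Finset.range (k+1),
            (k.choose i : ℂ) * iteratedDeriv i (fun w => deriv g (χ w)) a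
              * iteratedDeriv (k - i + 1) χ a := by
        intro χ hχ hgχ
        rw [iteratedDeriv_succ']
        have he : deriv (fun w => g (χ w)) =ᶠ[𝓝 a] (fun w => deriv g (χ w) * deriv χ w) := by
          filter_upwards [hχ.eventually_analyticAt,
            hχ.continuousAt.eventually hgχ.eventually_analyticAt] with w hw1 hw2
          exact (hw2.differentiableAt.hasDerivAt.comp w hw1.differentiableAt.hasDerivAt).deriv
        rw [he.iteratedDeriv_eq k]
        rw [iteratedDeriv_fun_mul]
        · simp only [iteratedDeriv_succ']
        · exact (hgχ.deriv.comp hχ).contDiffAt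
        · exact hχ.deriv.contDiffAt
      rw [key φ hφ hg, key ψ hψ (h00 ▸ hg)]
      refine Finset.sum_congr rfl fun i hi => ?_
      have hi' : i ≤ k := by simpa [Nat.lt_succ_iff] using hi
      rw [hj (k - i + 1) (by omega)]
      rw [ih i (by omega) (deriv g) φ ψ a hφ hψ hg.deriv (fun l hl => hj l (by omega))]

lemma iD_shift (k : ℕ) (f : ℂ → ℂ) (z w : ℂ) :
    iteratedDeriv k (fun w => f (z + w)) w = iteratedDeriv k f (z + w) := by
  have := congrFun (iteratedDerivWithin_comp_const_add (s := Set.univ) (n := k) (f := f) z) w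
  simpa [iteratedDerivWithin_univ] using this

lemma comp_bound {f g : ℂ → ℂ} {z : ℂ} {U : Set ℂ} (hU : IsOpen U) (hf : AnalyticAt ℂ f z)
    (hg : DifferentiableOn ℂ g U) {δ C G ρ : ℝ} (hδ : 0 < δ) (hC : 0 < C) (hρ : 0 < ρ)
    (hsub : Metric.closedBall (f z) δ ⊆ U) (hG : ∀ w ∈ Metric.closedBall (f z) δ, ‖g w‖ ≤ G)
    (k : ℕ) (hb : ∀ j, 1 ≤ j → j ≤ k → ‖iteratedDeriv j f z‖ ≤ C * j.factorial * ρ ^ j) :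
    ‖iteratedDeriv k (fun w => g (f w)) z‖ ≤ k.factorial * G * (ρ * ((C + δ) / δ)) ^ k := by
  classical
  set x := δ / (C + δ) with hx
  have hx0 : 0 < x := by positivity
  have hx1 : x < 1 := by rw [hx, div_lt_one (by positivity)]; linarith
  let P : Polynomial ℂ := ∑ j ∈ Finset.range (k+1),
    Polynomial.monomial j (iteratedDeriv j f z / j.factorial)
  have hcoeff : ∀ j ≤ k, P.coeff j = iteratedDeriv j f z / j.factorial := by
    intro j hj
    simp only [P, Polynomial.finsetSum_coeff, Polynomial.coeff_monomial]
    rw [Finset.sum_ite_eq' , if_pos (by simp; omega)]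
  have heval : ∀ w, P.eval w = ∑ j ∈ Finset.range (k+1), iteratedDeriv j f z / j.factorial * w ^ j := by
    intro w
    simp [P, Polynomial.eval_finsetSum]
  have hP0 : P.eval 0 = f z := by
    rw [heval, Finset.sum_range_succ']; simp
  set r := x / ρ with hr
  have hr0 : 0 < r := by positivity
  have hin : ∀ w ∈ Metric.closedBall (0:ℂ) r, P.eval w ∈ Metric.closedBall (f z) δ := by
    intro w hw
    rw [mem_closedBall_zero_iff] at hw
    rw [mem_closedBall_iff_norm, heval, Finset.sum_range_succ']
    simp only [iteratedDeriv_zero, Nat.factorial_zero, Nat.cast_one, div_one, pow_zero, mul_one,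
      add_sub_cancel_right]
    calc ‖∑ j ∈ Finset.range k, iteratedDeriv (j+1) f z / ((j+1).factorial) * w ^ (j+1)‖
        ≤ ∑ j ∈ Finset.range k, C * x * x ^ j := by
          refine norm_sum_le_of_le _ fun j hj => ?_
          have hj' : j < k := by simpa using hj
          rw [norm_mul, norm_div, norm_pow]
          have hfac : (0:ℝ) < (j+1).factorial := by positivity
          have h1 : ‖iteratedDeriv (j+1) f z‖ / ‖(((j+1).factorial : ℕ) : ℂ)‖ ≤ C * ρ ^ (j+1) := by
            rw [Complex.norm_natCast, div_le_iff₀ hfac]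
            calc _ ≤ _ := hb (j+1) (by omega) hj'
              _ = _ := by ring
          calc _ ≤ C * ρ ^ (j+1) * r ^ (j+1) := by gcongr
            _ = C * (ρ * r) ^ (j+1) := by rw [mul_pow]; ring
            _ = C * x * x ^ j := by rw [hr, mul_div_cancel₀ _ hρ.ne']; ring
      _ = C * x * ∑ j ∈ Finset.range k, x ^ j := by rw [Finset.mul_sum]
      _ ≤ C * x * (1 - x)⁻¹ := by
          gcongr
          have := Summable.sum_le_tsum (Finset.range k) (fun j _ => by positivity)
            (summable_geometric_of_lt_one hx0.le hx1)
          rwa [tsum_geometric_of_lt_one hx0.le hx1] at this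
      _ = δ := by
          rw [hx]
          have : C + δ ≠ 0 := by positivity
          have h3 : 1 - δ / (C + δ) = C / (C + δ) := by field_simp; ring
          rw [h3]; field_simp
  have hcauchy : ‖iteratedDeriv k (fun w => g (P.eval w)) 0‖ ≤ k.factorial * G / r ^ k := by
    refine Complex.norm_iteratedDeriv_le_of_forall_mem_sphere_norm_le k hr0 ?_ ?_
    · have hd : ∀ w ∈ Metric.closedBall (0:ℂ) r, DifferentiableAt ℂ (fun w => g (P.eval w)) w := by
        intro w hw
        exact (hg.differentiableAt (hU.mem_nhds (hsub (hin w hw)))).comp w P.differentiable.differentiableAt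
      refine DifferentiableOn.diffContOnCl ?_
      rw [closure_ball _ hr0.ne']
      exact fun w hw => (hd w hw).differentiableWithinAt
    · intro w hw
      exact hG _ (hin w (Metric.sphere_subset_closedBall hw))
  have hjet : iteratedDeriv k (fun w => g (f w)) z = iteratedDeriv k (fun w => g (P.eval w)) 0 := by
    have e1 := iD_shift k (fun w => g (f w)) z 0
    rw [add_zero] at e1
    rw [← e1]
    refine jet_comp k g (fun w => f (z + w)) (fun w => P.eval w) 0 ?_ ?_ ?_ ?_
    · have : AnalyticAt ℂ f (z + 0) := by simpa using hf
      exact this.comp_of_eq (by fun_prop) rfl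
    · exact P.differentiable.analyticAt 0
    · simp only [add_zero]
      exact hg.analyticAt (hU.mem_nhds (hsub (Metric.mem_closedBall_self hδ.le)))
    · intro i hi
      rw [iD_shift, poly_iteratedDeriv_zero, hcoeff i hi, add_zero]
      have : (i.factorial : ℂ) ≠ 0 := by exact_mod_cast Nat.factorial_ne_zero i
      field_simp
  rw [hjet]
  refine hcauchy.trans (le_of_eq ?_)
  rw [hr, hx, div_eq_mul_inv, ← inv_pow]
  congr 2
  field_simp

lemma a_imp_b {M : ℝ → ℕ → ℝ} (hM : IsWeightMatrix M)
    {α : ℝ} (hα : 0 < α) (hα1 : α ≤ 1) {Lmin : ℝ → ℕ → ℝ}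
    (hLmin : ∀ p > (0:ℝ), IsLcMinorant (fun j => Gbar (1 - α) j * M p j) (Lmin p))
    (hrai : Mrai (fun p j => Gbar (α - 1) j * Lmin p j)) : HolClosed (AMatSet M α) α := by
  rintro f ⟨p, hp, hf⟩ U hU hfU g hg
  obtain ⟨C, hC, h, hh, hb⟩ := reg_of_mem hα hα1 (hM.1 p hp) (hLmin p hp) hf
  obtain ⟨D, hD, p', hp', hrai⟩ := hrai p hp
  have hSo := sector_open hα hα1
  have hK : IsCompact (closure (f '' Sector α)) := by
    refine Bornology.IsBounded.isCompact_closure ?_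
    rw [isBounded_iff_forall_norm_le]
    refine ⟨C * h ^ 0 * (Gbar (α-1) 0 * Lmin p 0), ?_⟩
    rintro _ ⟨z, hz, rfl⟩
    simpa using hb 0 z hz
  obtain ⟨δ, hδ, hδU⟩ := hK.exists_cthickening_subset_open hU hfU
  obtain ⟨G, hG⟩ := hK.cthickening (r := δ) |>.exists_bound_of_continuousOn
    (hg.continuousOn.mono hδU)
  have hballs : ∀ z ∈ Sector α, Metric.closedBall (f z) δ ⊆ Metric.cthickening δ (closure (f '' Sector α)) :=
    fun z hz => Metric.closedBall_subset_cthickening (subset_closure (Set.mem_image_of_mem f hz)) δ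
  have hdf : DifferentiableOn ℂ (g ∘ f) (Sector α) :=
    hg.comp hf.1 (fun z hz => hfU (subset_closure (Set.mem_image_of_mem f hz)))
  have hN : ∀ q > 0, ∀ j, 0 < Gbar (α-1) j * Lmin q j :=
    fun q hq j => mul_pos (Gbar_pos _ _) ((hLmin q hq).1 j)
  have hGpos : 0 ≤ G := by
    obtain ⟨z, hz⟩ : ∃ z, z ∈ Sector α := ⟨_, pos_mem_sector hα hα1 one_pos⟩
    exact (norm_nonneg _).trans (hG (f z) (hballs z hz (Metric.mem_closedBall_self hδ.le)))
  refine ⟨p', hp', mem_of_bound hα hα1 hdf (C := G) (h := h * D * ((C + δ) / δ)) (by positivity) ?_⟩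
  intro k z hz
  rcases Nat.eq_zero_or_pos k with rfl | hk
  · simp only [iteratedDeriv_zero, pow_zero, mul_one, Function.comp]
    rw [hM.2.1 p' hp', mul_one]
    exact hG _ (hballs z hz (Metric.mem_closedBall_self hδ.le))
  set N' := Gbar (α-1) k * Lmin p' k with hN'
  have hN'pos : 0 < N' := hN p' hp' k
  set v := (N' / k.factorial) ^ ((k:ℝ)⁻¹) with hv
  have hfk : (0:ℝ) < k.factorial := by positivity
  have hvpos : 0 < v := by positivity
  have hvk : v ^ k = N' / k.factorial := by
    rw [hv, Real.rpow_inv_natCast_pow (by positivity) (by omega)]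
  have := comp_bound (f := f) (g := g) (z := z) (δ := δ) (C := C) (G := G) (ρ := h * D * v) hU
    (hf.1.analyticAt (hSo.mem_nhds hz)) hg hδ hC (by positivity)
    ((hballs z hz).trans hδU) (fun w hw => hG w (hballs z hz hw)) k ?_
  · refine this.trans ?_
    calc _ = G * (h * D * ((C + δ) / δ)) ^ k * (k.factorial * v ^ k) := by
          rw [show h * D * v * ((C + δ) / δ) = h * D * ((C + δ) / δ) * v by ring, mul_pow]; ring
      _ = G * (h * D * ((C + δ) / δ)) ^ k * N' := by rw [hvk]; field_simp
      _ ≤ _ := by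
          gcongr
          exact N_le_M (hLmin p' hp') k
  · intro j hj hjk
    have h1 := hrai j k hj hjk
    simp only [checkSeq] at h1
    rw [← hN', ← hv] at h1
    have hNj := hN p hp j
    have hfj : (0:ℝ) < j.factorial := by positivity
    have h2 : Gbar (α-1) j * Lmin p j / j.factorial ≤ (D * v) ^ j := by
      have := pow_le_pow_left₀ (by positivity) h1 j
      rwa [Real.rpow_inv_natCast_pow (by positivity) (by omega)] at this
    rw [div_le_iff₀ hfj] at h2
    calc _ ≤ _ := hb j z hz
      _ ≤ C * h ^ j * ((D * v) ^ j * j.factorial) := by gcongr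
      _ = _ := by rw [mul_assoc h D v, mul_pow]; ring

lemma b_imp_c {M : ℝ → ℕ → ℝ} {α : ℝ} (hb : HolClosed (AMatSet M α) α) :
    InvClosed (AMatSet M α) α := by
  rintro f hf ⟨c, hc, hfc⟩
  refine hb f hf {0}ᶜ isOpen_compl_singleton ?_ (fun w => w⁻¹) ?_
  · have hcl : closure (f '' Sector α) ⊆ {w | c ≤ ‖w‖} := by
      refine closure_minimal ?_ (isClosed_le continuous_const continuous_norm)
      rintro _ ⟨z, hz, rfl⟩
      exact hfc z hz
    intro w hw h0
    have h2 : c ≤ ‖w‖ := hcl hw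
    rw [Set.mem_singleton_iff] at h0
    rw [h0, norm_zero] at h2
    linarith
  · exact differentiableOn_inv.congr (fun _ _ => rfl)

end UH

namespace UH
open MeasureTheory

lemma laplace_norm_int {s b : ℝ} (hs : -1 < s) (hb : 0 < b) :
    IntegrableOn (fun t : ℝ => t ^ s * Real.exp (-b * t)) (Set.Ioi 0) := by
  have := integrableOn_rpow_mul_exp_neg_mul_rpow (p := 1) hs one_pos hb
  simpa using this

lemma laplace_int {s : ℝ} (hs : -1 < s) {r : ℂ} (hr : 0 < r.re) :
    IntegrableOn (fun t : ℝ => ((t ^ s : ℝ) : ℂ) * exp (-(r * t))) (Set.Ioi 0) := by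
  refine Integrable.mono' (laplace_norm_int hs hr) ?_ ?_
  · refine Measurable.aestronglyMeasurable ?_
    fun_prop
  · refine (ae_restrict_iff' measurableSet_Ioi).2 (Eventually.of_forall fun t ht => ?_)
    have ht' : 0 < t := ht
    rw [norm_mul, Complex.norm_exp, Complex.norm_real, Real.norm_of_nonneg (by positivity)]
    simp

lemma laplace_diff {s : ℝ} (hs : -1 < s) :
    DifferentiableOn ℂ (fun r : ℂ => ∫ t in Set.Ioi (0:ℝ), ((t ^ s : ℝ) : ℂ) * exp (-(r * t)))
      {r : ℂ | 0 < r.re} := by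
  intro r hr
  have hr : 0 < r.re := hr
  have hopen : IsOpen {w : ℂ | r.re / 2 < w.re} := isOpen_lt continuous_const Complex.continuous_re
  have := hasDerivAt_integral_of_dominated_loc_of_deriv_le (𝕜 := ℂ)
    (μ := volume.restrict (Set.Ioi (0:ℝ))) (x₀ := r)
    (F := fun (r : ℂ) (t : ℝ) => ((t ^ s : ℝ) : ℂ) * exp (-(r * t)))
    (F' := fun (r : ℂ) (t : ℝ) => ((t ^ s : ℝ) : ℂ) * (exp (-(r * t)) * (-t)))
    (bound := fun t : ℝ => t ^ (s+1) * Real.exp (-(r.re/2) * t))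
    (s := {w : ℂ | r.re / 2 < w.re}) (hopen.mem_nhds (by show r.re / 2 < r.re; linarith))
    ?_ (laplace_int hs hr) ?_ ?_ ?_ ?_
  · exact this.2.differentiableAt.differentiableWithinAt
  · refine Eventually.of_forall fun w => Measurable.aestronglyMeasurable ?_
    fun_prop
  · refine Measurable.aestronglyMeasurable ?_
    fun_prop
  · refine (ae_restrict_iff' measurableSet_Ioi).2 (Eventually.of_forall fun t ht w hw => ?_)
    have ht' : 0 < t := ht
    have hw' : r.re / 2 < w.re := hw
    rw [norm_mul, norm_mul, Complex.norm_exp, Complex.norm_real, Real.norm_of_nonneg (by positivity),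
      norm_neg, Complex.norm_real, Real.norm_of_nonneg ht'.le, Real.rpow_add ht', Real.rpow_one]
    have : Real.exp (-(w * t)).re ≤ Real.exp (-(r.re/2) * t) := by
      apply Real.exp_le_exp.2
      simp
      nlinarith
    calc _ = t ^ s * t * Real.exp (-(w * t)).re := by ring
      _ ≤ _ := by gcongr
  · exact laplace_norm_int (by linarith) (by linarith)
  · refine Eventually.of_forall fun t w _ => ?_
    refine HasDerivAt.const_mul _ ?_
    refine HasDerivAt.cexp ?_
    have := ((hasDerivAt_id' w).mul_const (t:ℂ)).fun_neg
    refine this.congr_deriv ?_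
    rw [one_mul]

lemma laplace_eq {s : ℝ} (hs : 0 < s) {r : ℂ} (hr : 0 < r.re) :
    ∫ t in Set.Ioi (0:ℝ), ((t ^ (s-1) : ℝ) : ℂ) * exp (-(r * t)) =
      ((Real.Gamma s : ℝ) : ℂ) * r ^ (-(s:ℂ)) := by
  have hopen : IsOpen {w : ℂ | 0 < w.re} := isOpen_lt continuous_const Complex.continuous_re
  have hpre : IsPreconnected {w : ℂ | 0 < w.re} :=
    (convex_halfSpace_re_gt 0).isPreconnected
  have hA : AnalyticOnNhd ℂ (fun r : ℂ => ∫ t in Set.Ioi (0:ℝ), ((t ^ (s-1) : ℝ) : ℂ) * exp (-(r * t)))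
      {w : ℂ | 0 < w.re} := (laplace_diff (by linarith)).analyticOnNhd hopen
  have hB : AnalyticOnNhd ℂ (fun r : ℂ => ((Real.Gamma s : ℝ) : ℂ) * r ^ (-(s:ℂ)))
      {w : ℂ | 0 < w.re} := by
    refine DifferentiableOn.analyticOnNhd ?_ hopen
    intro w hw
    have hw : 0 < w.re := hw
    refine DifferentiableAt.differentiableWithinAt ?_
    refine DifferentiableAt.const_mul ?_ _
    exact (differentiableAt_id).cpow (differentiableAt_const _) (Or.inl hw)
  have h1 : (1:ℂ) ∈ {w : ℂ | 0 < w.re} := by rw [Set.mem_ofPred_eq]; simp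
  refine hA.eqOn_of_preconnected_of_frequently_eq hB hpre h1 ?_ hr
  have ht : Tendsto (fun n : ℕ => ((1 + 1 / ((n:ℝ) + 1) : ℝ) : ℂ)) atTop (𝓝[≠] 1) := by
    rw [tendsto_nhdsWithin_iff]
    constructor
    · have : Tendsto (fun n : ℕ => (1 + 1 / ((n:ℝ) + 1) : ℝ)) atTop (𝓝 (1 + 0)) :=
        tendsto_const_nhds.add tendsto_one_div_add_atTop_nhds_zero_nat
      rw [add_zero] at this
      have h3 := (Complex.continuous_ofReal.tendsto 1).comp this
      rw [Complex.ofReal_one] at h3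
      exact h3
    · refine Eventually.of_forall fun n h => ?_
      rw [Set.mem_singleton_iff] at h
      have h2 : (1 + 1 / ((n:ℝ) + 1) : ℝ) = 1 := by exact_mod_cast h
      have : 0 < 1 / ((n:ℝ) + 1) := by positivity
      linarith
  refine ht.frequently (Frequently.of_forall fun n => ?_)
  set x : ℝ := 1 + 1 / ((n:ℝ) + 1) with hx
  have hx0 : 0 < x := by positivity
  have := Complex.integral_cpow_mul_exp_neg_mul_Ioi (a := (s:ℂ)) (r := x) (by simpa using hs) hx0
  rw [Complex.Gamma_ofReal] at this
  have e : ∀ t ∈ Set.Ioi (0:ℝ), ((t ^ (s-1) : ℝ) : ℂ) * exp (-((x:ℂ) * t))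
      = (t:ℂ) ^ ((s:ℂ) - 1) * exp (-((x:ℂ) * t)) := by
    intro t ht
    have ht' : 0 < t := ht
    rw [Complex.ofReal_cpow ht'.le]; push_cast; rfl
  rw [setIntegral_congr_fun measurableSet_Ioi e, this, mul_comm, one_div, Complex.inv_cpow,
    Complex.cpow_neg]
  rw [Complex.arg_ofReal_of_nonneg hx0.le]
  exact Real.pi_pos.ne

/-- the point of the vertical line -/
def uu (R ξ : ℝ) : ℂ := (R:ℂ) + ((2 * Real.pi * ξ : ℝ) : ℂ) * I

lemma uu_re (R ξ : ℝ) : (uu R ξ).re = R := by simp [uu]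
lemma uu_ne {R : ℝ} (hR : 0 < R) (ξ : ℝ) : uu R ξ ≠ 0 := by
  intro h; have := uu_re R ξ; rw [h] at this; simp at this; linarith
lemma uu_cont (R : ℝ) : Continuous (uu R) := by unfold uu; fun_prop
lemma uu_norm_ge {R : ℝ} (hR : 0 < R) (ξ : ℝ) : R ≤ ‖uu R ξ‖ := by
  have := Complex.re_le_norm (uu R ξ); rwa [uu_re] at this
lemma uu_sq {R : ℝ} (hR : 1 ≤ R) (ξ : ℝ) : 1 + ξ ^ 2 ≤ ‖uu R ξ‖ ^ 2 := by
  rw [← Complex.normSq_eq_norm_sq, Complex.normSq_apply]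
  have h1 : (uu R ξ).im = 2 * Real.pi * ξ := by simp [uu]
  rw [uu_re, h1]
  have h3 := Real.pi_gt_three
  have : ξ^2 ≤ (2 * Real.pi * ξ) * (2 * Real.pi * ξ) := by
    have : (1:ℝ) ≤ (2 * Real.pi)^2 := by nlinarith
    nlinarith [sq_nonneg ξ]
  nlinarith

lemma uu_cpow_norm {R : ℝ} (hR : 1 ≤ R) {s : ℝ} (hs : 2 ≤ s) (ξ : ℝ) :
    ‖uu R ξ ^ (-(s:ℂ))‖ ≤ R ^ (2 - s) * (1 + ξ ^ 2)⁻¹ := by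
  have hR0 : 0 < R := by linarith
  have hne := uu_ne hR0 ξ
  have hn : 0 < ‖uu R ξ‖ := norm_pos_iff.2 hne
  have e : ‖uu R ξ ^ (-(s:ℂ))‖ = ‖uu R ξ‖ ^ (-s) := by
    have := Complex.norm_cpow_of_ne_zero hne (-(s:ℂ))
    rw [this]; simp
  rw [e, show -s = (2 - s) + (-2) by ring, Real.rpow_add hn]
  have h1 : ‖uu R ξ‖ ^ (2 - s) ≤ R ^ (2 - s) :=
    Real.rpow_le_rpow_of_nonpos hR0 (uu_norm_ge hR0 ξ) (by linarith)
  have h2 : ‖uu R ξ‖ ^ (-2:ℝ) ≤ (1 + ξ^2)⁻¹ := by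
    rw [Real.rpow_neg hn.le]
    refine inv_anti₀ (by positivity) ?_
    have := uu_sq hR ξ
    exact_mod_cast this
  gcongr

lemma uu_cpow_cont {R : ℝ} (hR : 0 < R) (c : ℂ) : Continuous (fun ξ => uu R ξ ^ c) := by
  refine Continuous.cpow (uu_cont R) continuous_const fun ξ => Or.inl ?_
  rw [uu_re]; exact hR

lemma uu_cpow_int {R : ℝ} (hR : 1 ≤ R) {s : ℝ} (hs : 2 ≤ s) :
    Integrable (fun ξ => uu R ξ ^ (-(s:ℂ))) := by
  refine Integrable.mono' ((integrable_inv_one_add_sq).const_mul (R ^ (2-s)))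
    (uu_cpow_cont (by linarith) _).aestronglyMeasurable
    (Eventually.of_forall fun ξ => uu_cpow_norm hR hs ξ)

lemma exp_uu_norm (R ξ : ℝ) : ‖exp (uu R ξ)‖ = Real.exp R := by
  rw [Complex.norm_exp, uu_re]

lemma inv_gamma {R : ℝ} (hR : 1 ≤ R) {s : ℝ} (hs : 2 ≤ s) :
    ∫ ξ, exp (uu R ξ) * uu R ξ ^ (-(s:ℂ)) = (((Real.Gamma s)⁻¹ : ℝ) : ℂ) := by
  have hR0 : 0 < R := by linarith
  set g : ℝ → ℂ := Set.indicator (Set.Ioi 0)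
    (fun t : ℝ => ((t ^ (s-1) : ℝ) : ℂ) * exp (-((R:ℂ) * t))) with hg
  have hgi : Integrable g := by
    rw [hg, integrable_indicator_iff measurableSet_Ioi]
    exact laplace_int (by linarith) (by simpa using hR0)
  have hF : FourierTransform.fourier g = fun ξ => ((Real.Gamma s : ℝ):ℂ) * uu R ξ ^ (-(s:ℂ)) := by
    ext ξ
    rw [Real.fourier_real_eq_integral_exp_smul, ← laplace_eq (by linarith) (by rw [uu_re]; exact hR0),
      ← integral_indicator measurableSet_Ioi]
    congr 1
    ext t
    rw [hg]
    by_cases ht : t ∈ Set.Ioi (0:ℝ)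
    · rw [Set.indicator_of_mem ht, Set.indicator_of_mem ht, smul_eq_mul, mul_left_comm,
        ← Complex.exp_add]
      congr 2
      simp only [uu]; push_cast; ring
    · rw [Set.indicator_of_notMem ht, Set.indicator_of_notMem ht, smul_zero]
  have hFi : Integrable (FourierTransform.fourier g) := by
    rw [hF]; exact (uu_cpow_int hR hs).const_mul _
  have hc : ContinuousAt g 1 := by
    have : g =ᶠ[𝓝 1] (fun t : ℝ => ((t ^ (s-1) : ℝ) : ℂ) * exp (-((R:ℂ) * t))) := by
      filter_upwards [Ioi_mem_nhds (zero_lt_one (α := ℝ))] with t ht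
      rw [hg, Set.indicator_of_mem ht]
    refine ContinuousAt.congr ?_ this.symm
    refine ContinuousAt.mul ?_ (by fun_prop)
    refine Complex.continuous_ofReal.continuousAt.comp ?_
    exact Real.continuousAt_rpow_const _ _ (Or.inl one_ne_zero)
  have hinv := hgi.fourierInv_fourier_eq hFi hc
  rw [Real.fourierInv_eq', hF] at hinv
  have hg1 : g 1 = exp (-(R:ℂ)) := by
    rw [hg, Set.indicator_of_mem (by simp)]; simp
  rw [hg1] at hinv
  have hΓ : (0:ℝ) < Real.Gamma s := Real.Gamma_pos_of_pos (by linarith)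
  have hΓ' : ((Real.Gamma s : ℝ):ℂ) ≠ 0 := by exact_mod_cast hΓ.ne'
  have e2 : ∫ ξ, exp (uu R ξ) * uu R ξ ^ (-(s:ℂ)) = exp R * ((Real.Gamma s : ℝ):ℂ)⁻¹ *
      ∫ v : ℝ, exp (((2 * Real.pi * inner ℝ v 1 : ℝ):ℂ) * I) • (((Real.Gamma s : ℝ):ℂ) * uu R v ^ (-(s:ℂ))) := by
    rw [← integral_const_mul]
    congr 1
    ext ξ
    rw [smul_eq_mul, show uu R ξ = (R:ℂ) + ((2 * Real.pi * ξ : ℝ) : ℂ) * I from rfl, Complex.exp_add]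
    simp only [Real.inner_apply, mul_one]
    field_simp
  rw [e2, hinv, Complex.exp_neg]
  have := Complex.exp_ne_zero R
  push_cast
  field_simp

end UH

namespace UH
open MeasureTheory

lemma one_le_gamma {s : ℝ} (hs : 2 ≤ s) : 1 ≤ Real.Gamma s := by
  have hc := Real.convexOn_Gamma
  have hs1 : 0 < s - 1 := by linarith
  have hb0 : 0 < (s-1)⁻¹ := by positivity
  have hb1 : (s-1)⁻¹ ≤ 1 := inv_le_one_of_one_le₀ (by linarith)
  have m1 : (1:ℝ) ∈ Set.Ioi (0:ℝ) := by simp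
  have m2 : s ∈ Set.Ioi (0:ℝ) := by rw [Set.mem_Ioi]; linarith
  have m3 : 0 ≤ 1 - (s-1)⁻¹ := by linarith
  have := hc.2 m1 m2 m3 hb0.le (by ring)
  simp only [smul_eq_mul] at this
  rw [show (1 - (s-1)⁻¹) * 1 + (s-1)⁻¹ * s = 2 by field_simp; ring, Real.Gamma_two, Real.Gamma_one] at this
  have h2 : (s-1)⁻¹ * 1 ≤ (s-1)⁻¹ * Real.Gamma s := by linarith
  exact le_of_mul_le_mul_left h2 hb0

/-- Wright function coefficients -/
def wc (σ s : ℝ) (k : ℕ) : ℂ := (((Real.Gamma (σ * k + s))⁻¹ : ℝ) : ℂ)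

lemma wc_norm {σ s : ℝ} (hσ : 0 ≤ σ) (hs : 2 ≤ s) (k : ℕ) : ‖wc σ s k‖ ≤ 1 := by
  have h2 : 2 ≤ σ * k + s := by have : 0 ≤ σ * k := by positivity
                                linarith
  have := one_le_gamma h2
  rw [wc, Complex.norm_real, Real.norm_of_nonneg (by positivity)]
  exact inv_le_one_of_one_le₀ this

/-- Wright function -/
def Wr (σ s : ℝ) (z : ℂ) : ℂ := ∑' k : ℕ, (-z) ^ k / k.factorial * wc σ s k

lemma Wr_deriv {σ s : ℝ} (hσ : 0 ≤ σ) (hs : 2 ≤ s) (z : ℂ) :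
    HasDerivAt (Wr σ s) (-(Wr σ (s + σ) z)) z := by
  set r := ‖z‖ + 1 with hr
  have hr0 : 0 < r := by positivity
  let g' : ℕ → ℂ → ℂ := fun k y => match k with
    | 0 => 0
    | k+1 => -((-y) ^ k / k.factorial * wc σ (s+σ) k)
  let u : ℕ → ℝ := fun k => match k with
    | 0 => 0
    | k+1 => r ^ k / k.factorial
  have hu : Summable u := by
    rw [← summable_nat_add_iff 1]
    exact Real.summable_pow_div_factorial r
  have hmem : z ∈ Metric.ball (0:ℂ) r := by rw [mem_ball_zero_iff]; linarith
  have := hasDerivAt_tsum_of_isPreconnected (g := fun (k:ℕ) (y:ℂ) => (-y) ^ k / k.factorial * wc σ s k)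
    (g' := g') (u := u) (t := Metric.ball (0:ℂ) r) (y₀ := 0) (y := z) hu Metric.isOpen_ball
    (convex_ball _ _).isPreconnected ?_ ?_ (Metric.mem_ball_self hr0) ?_ hmem
  · refine this.congr_deriv ?_
    have hs' : Summable (fun k => g' k z) := by
      refine Summable.of_norm_bounded hu fun k => ?_
      rcases k with _ | k
      · simp [g', u]
      · simp only [g', u, norm_neg, norm_mul, norm_div, norm_pow, Complex.norm_natCast]
        calc ‖z‖ ^ k / k.factorial * ‖wc σ (s+σ) k‖ ≤ r ^ k / k.factorial * 1 := by
              gcongr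
              · linarith
              · exact wc_norm hσ (by linarith) k
          _ = _ := mul_one _
    rw [hs'.tsum_eq_zero_add, Wr]
    simp only [g', zero_add]
    rw [tsum_neg]
  · intro k y _
    rcases k with _ | k
    · simp only [g', pow_zero]
      exact hasDerivAt_const _ _
    · have h1 := ((((hasDerivAt_id' y).fun_neg).fun_pow (k+1)).div_const ((k+1).factorial : ℂ)).mul_const
        (wc σ s (k+1))
      refine h1.congr_deriv ?_
      simp only [g']
      have e : wc σ s (k+1) = wc σ (s+σ) k := by
        simp only [wc]; push_cast; rw [show σ * ((k:ℝ)+1) + s = σ * k + (s + σ) by ring]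
      rw [e, Nat.factorial_succ]
      have : (k.factorial : ℂ) ≠ 0 := by exact_mod_cast Nat.factorial_ne_zero k
      have h2 : (k : ℂ) + 1 ≠ 0 := by exact_mod_cast Nat.succ_ne_zero k
      push_cast
      field_simp
  · intro k y hy
    rw [mem_ball_zero_iff] at hy
    rcases k with _ | k
    · simp [g', u]
    · simp only [g', u, norm_neg, norm_mul, norm_div, norm_pow, Complex.norm_natCast]
      calc ‖y‖ ^ k / k.factorial * ‖wc σ (s+σ) k‖ ≤ r ^ k / k.factorial * 1 := by
            gcongr
            exact wc_norm hσ (by linarith) k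
        _ = _ := mul_one _
  · refine summable_of_ne_finset_zero (s := {0}) fun k hk => ?_
    simp at hk
    simp [hk]

lemma Wr_zero (σ s : ℝ) : Wr σ s 0 = (((Real.Gamma s)⁻¹ : ℝ) : ℂ) := by
  rw [Wr, tsum_eq_single 0]
  · simp [wc]
  · intro k hk; simp [hk]

/-- universal constant -/
def KK : ℝ := ∫ ξ : ℝ, (1 + ξ ^ 2)⁻¹

lemma KK_nonneg : 0 ≤ KK := integral_nonneg fun ξ => by positivity

lemma wright_re {α : ℝ} (h0 : 0 < α) (h1 : α ≤ 1) {z u : ℂ} (hz : z ∈ Sector α) (hu : 0 < u.re) :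
    0 ≤ (z * u ^ (-((1-α : ℝ) : ℂ))).re := by
  have hz0 : z ≠ 0 := hz.1
  have hz1 : |Complex.arg z| < α * Real.pi / 2 := hz.2
  have hu0 : u ≠ 0 := by rintro rfl; simp at hu
  have hua : |Complex.arg u| ≤ Real.pi / 2 := Complex.abs_arg_le_pi_div_two_iff.2 hu.le
  have e : z * u ^ (-((1-α : ℝ) : ℂ)) = exp (log z + log u * (-((1-α : ℝ) : ℂ))) := by
    rw [Complex.exp_add, Complex.exp_log hz0, Complex.cpow_def_of_ne_zero hu0]
  rw [e, Complex.exp_re]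
  refine mul_nonneg (Real.exp_pos _).le ?_
  have him : (log z + log u * (-((1-α : ℝ) : ℂ))).im = arg z - (1-α) * arg u := by
    simp [Complex.log_im]; ring
  rw [him]
  have h3 : |(1-α) * arg u| ≤ (1-α) * (Real.pi/2) := by
    rw [abs_mul, abs_of_nonneg (by linarith)]
    exact mul_le_mul_of_nonneg_left hua (by linarith)
  rw [abs_lt] at hz1
  rw [abs_le] at h3
  apply Real.cos_nonneg_of_neg_pi_div_two_le_of_le <;> nlinarith [hz1.1, hz1.2, h3.1, h3.2]

lemma Wr_integral {σ s R : ℝ} (hσ : 0 ≤ σ) (hs : 2 ≤ s) (hR : 1 ≤ R) (z : ℂ) :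
    Wr σ s z = ∫ ξ, exp (uu R ξ) * uu R ξ ^ (-(s:ℂ)) * exp (-(z * uu R ξ ^ (-(σ:ℂ)))) := by
  have hR0 : 0 < R := by linarith
  have hsk : ∀ k : ℕ, 2 ≤ σ * k + s := fun k => by
    have : 0 ≤ σ * k := by positivity
    linarith
  let F : ℕ → ℝ → ℂ := fun k ξ => (-z) ^ k / k.factorial *
    (exp (uu R ξ) * uu R ξ ^ (-((σ * k + s : ℝ):ℂ)))
  have hbase : ∀ k : ℕ, ∀ ξ, ‖exp (uu R ξ) * uu R ξ ^ (-((σ * k + s : ℝ):ℂ))‖ ≤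
      Real.exp R * (1 + ξ ^ 2)⁻¹ := by
    intro k ξ
    rw [norm_mul, exp_uu_norm]
    have h1 := uu_cpow_norm hR (hsk k) ξ
    have h2 : R ^ (2 - (σ * k + s)) ≤ 1 := Real.rpow_le_one_of_one_le_of_nonpos hR (by linarith [hsk k])
    gcongr
    refine h1.trans ?_
    have : 0 ≤ (1 + ξ^2)⁻¹ := by positivity
    nlinarith
  have hbint : Integrable (fun ξ : ℝ => Real.exp R * (1 + ξ ^ 2)⁻¹) :=
    integrable_inv_one_add_sq.const_mul _
  have hFint : ∀ k, Integrable (F k) := by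
    intro k
    refine Integrable.const_mul ?_ _
    refine Integrable.mono' hbint ?_ (Eventually.of_forall (hbase k))
    exact ((Complex.continuous_exp.comp (uu_cont R)).mul (uu_cpow_cont hR0 _)).aestronglyMeasurable
  have hval : ∀ k, ∫ ξ, F k ξ = (-z) ^ k / k.factorial * wc σ s k := by
    intro k
    simp only [F]
    rw [integral_const_mul, inv_gamma hR (hsk k), wc]
  have hsum : Summable (fun k => ∫ ξ, ‖F k ξ‖) := by
    have hb : ∀ k, ∫ ξ, ‖F k ξ‖ ≤ ‖z‖ ^ k / k.factorial * (Real.exp R * KK) := by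
      intro k
      calc ∫ ξ, ‖F k ξ‖ ≤ ∫ ξ, ‖z‖ ^ k / k.factorial * (Real.exp R * (1 + ξ ^ 2)⁻¹) := by
            refine integral_mono (hFint k).norm (hbint.const_mul _) fun ξ => ?_
            simp only [F]
            rw [norm_mul]
            have : ‖(-z) ^ k / (k.factorial:ℂ)‖ = ‖z‖ ^ k / k.factorial := by simp
            rw [this]
            gcongr
            exact hbase k ξ
        _ = _ := by rw [integral_const_mul, integral_const_mul, KK]
    refine Summable.of_nonneg_of_le (fun k => integral_nonneg fun ξ => norm_nonneg _) hb ?_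
    exact (Real.summable_pow_div_factorial ‖z‖).mul_right _
  have := hasSum_integral_of_summable_integral_norm hFint hsum
  rw [Wr, ← tsum_congr hval, this.tsum_eq]
  congr 1
  ext ξ
  have hne := uu_ne hR0 ξ
  have hF : ∀ k, F k ξ = exp (uu R ξ) * uu R ξ ^ (-(s:ℂ)) *
      ((-(z * uu R ξ ^ (-(σ:ℂ)))) ^ k / k.factorial) := by
    intro k
    simp only [F]
    have : uu R ξ ^ (-((σ * k + s : ℝ):ℂ)) = uu R ξ ^ (-(s:ℂ)) * (uu R ξ ^ (-(σ:ℂ))) ^ k := by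
      rw [← Complex.cpow_mul_nat, ← Complex.cpow_add _ _ hne]
      congr 1; push_cast; ring
    rw [this, ← neg_mul, mul_pow]
    ring
  rw [tsum_congr hF, tsum_mul_left]
  congr 1
  rw [Complex.exp_eq_exp_ℂ, NormedSpace.exp_eq_tsum_div]

lemma Wr_bound {α s R : ℝ} (h0 : 0 < α) (h1 : α ≤ 1) (hs : 2 ≤ s) (hR : 1 ≤ R) {z : ℂ}
    (hz : z ∈ Sector α) : ‖Wr (1-α) s z‖ ≤ Real.exp R * R ^ (2 - s) * KK := by
  have hR0 : 0 < R := by linarith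
  rw [Wr_integral (by linarith) hs hR, KK, ← integral_const_mul]
  refine norm_integral_le_of_norm_le (integrable_inv_one_add_sq.const_mul _)
    (Eventually.of_forall fun ξ => ?_)
  rw [norm_mul, norm_mul, exp_uu_norm]
  have h2 := uu_cpow_norm hR hs ξ
  have h3 : ‖exp (-(z * uu R ξ ^ (-((1-α : ℝ):ℂ))))‖ ≤ 1 := by
    rw [Complex.norm_exp, Real.exp_le_one_iff, Complex.neg_re]
    have := wright_re h0 h1 hz (u := uu R ξ) (by rw [uu_re]; exact hR0)
    linarith
  calc _ ≤ Real.exp R * (R ^ (2 - s) * (1 + ξ ^ 2)⁻¹) * 1 := by gcongr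
    _ = _ := by ring

/-- The basic system of functions. -/
def V (α : ℝ) (j : ℕ) (z : ℂ) : ℂ := (-1) ^ j * Wr (1-α) ((1-α) * j + 2) z

lemma V_deriv {α : ℝ} (h1 : α ≤ 1) (j : ℕ) (z : ℂ) : HasDerivAt (V α j) (V α (j+1) z) z := by
  have hs : 2 ≤ (1-α) * j + 2 := by
    have : 0 ≤ (1-α) * j := mul_nonneg (by linarith) (by positivity)
    linarith
  have := (Wr_deriv (σ := 1-α) (by linarith) hs z).const_mul ((-1:ℂ)^j)
  refine this.congr_deriv ?_
  simp only [V]; push_cast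
  rw [show (1-α) * ((j:ℝ)+1) + 2 = (1-α) * j + 2 + (1-α) by ring]
  ring

lemma V_zero (α : ℝ) (j : ℕ) : V α j 0 = (-1) ^ j * (((Real.Gamma ((1-α) * j + 2))⁻¹ : ℝ) : ℂ) := by
  rw [V, Wr_zero]

/-- bound constant -/
def KV : ℝ := Real.exp 1 * KK

lemma KV_nonneg : 0 ≤ KV := mul_nonneg (Real.exp_pos _).le KK_nonneg

lemma V_bound {α : ℝ} (h0 : 0 < α) (h1 : α ≤ 1) (j : ℕ) {z : ℂ} (hz : z ∈ Sector α) :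
    ‖V α j z‖ ≤ KV * Real.exp 1 ^ j * Gbar (α - 1) j := by
  have hs : 2 ≤ (1-α) * j + 2 := by
    have : 0 ≤ (1-α) * j := mul_nonneg (by linarith) (by positivity)
    linarith
  have hn : ‖V α j z‖ = ‖Wr (1-α) ((1-α) * j + 2) z‖ := by simp [V]
  rw [hn]
  rcases Nat.eq_zero_or_pos j with rfl | hj
  · have := Wr_bound h0 h1 hs le_rfl hz
    refine this.trans (le_of_eq ?_)
    simp [KV, Gbar]
  · have hj1 : (1:ℝ) ≤ j := by exact_mod_cast hj
    refine (Wr_bound h0 h1 hs hj1 hz).trans ?_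
    rw [← Real.exp_nat_mul, mul_one, Gbar, show 2 - ((1-α) * j + 2) = (α - 1) * j by ring, KV]
    have : 1 ≤ Real.exp 1 := Real.one_le_exp (by norm_num)
    have h5 : 0 ≤ Real.exp j * (j:ℝ) ^ ((α-1) * j) * KK := mul_nonneg (by positivity) KK_nonneg
    calc _ ≤ Real.exp 1 * (Real.exp j * (j:ℝ) ^ ((α-1) * j) * KK) := by nlinarith
      _ = _ := by ring

/-- lower bound on the values at the vertex -/
lemma gamma_upper {α : ℝ} (h0 : 0 < α) (h1 : α ≤ 1) (j : ℕ) :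
    (1/2) ^ j * Gbar (α - 1) j ≤ (Real.Gamma ((1-α) * j + 2))⁻¹ := by
  have hG0 : 0 < Real.Gamma ((1-α) * j + 2) := Real.Gamma_pos_of_pos (by
    have : 0 ≤ (1-α) * j := mul_nonneg (by linarith) (by positivity)
    linarith)
  have hup : Real.Gamma ((1-α) * j + 2) ≤ 2 ^ j * Gbar (1-α) j := by
    rcases Nat.eq_zero_or_pos j with rfl | hj
    · simp [Gbar]
    have hj1 : (1:ℝ) ≤ j := by exact_mod_cast hj
    have hjp : (0:ℝ) < j := by linarith
    have m1 : (j:ℝ) + 2 ∈ Set.Ioi (0:ℝ) := by rw [Set.mem_Ioi]; positivity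
    have m2 : (2:ℝ) ∈ Set.Ioi (0:ℝ) := by simp
    have m3 : 0 ≤ 1 - α := by linarith
    have hc := Real.convexOn_log_Gamma.2 m1 m2 m3 h0.le (by ring)
    simp only [smul_eq_mul, Function.comp] at hc
    rw [show (1-α) * ((j:ℝ)+2) + α * 2 = (1-α) * j + 2 by ring, Real.Gamma_two, Real.log_one,
      mul_zero, add_zero] at hc
    have hfac : Real.Gamma ((j:ℝ)+2) = (j+1).factorial := by
      have := Real.Gamma_nat_eq_factorial (j+1)
      push_cast at this
      rw [← this]; congr 1; ring
    have hfle : ((j+1).factorial : ℝ) ≤ 2 ^ j * (j:ℝ) ^ j := by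
      have h2 : j + 1 ≤ 2 ^ j := Nat.lt_two_pow_self
      have h3 : j.factorial ≤ j ^ j := Nat.factorial_le_pow j
      rw [Nat.factorial_succ]
      exact_mod_cast Nat.mul_le_mul h2 h3
    have hlog : Real.log ((j+1).factorial) ≤ j * Real.log 2 + j * Real.log j := by
      have := Real.log_le_log (by positivity) hfle
      rwa [Real.log_mul (by positivity) (by positivity), Real.log_pow, Real.log_pow] at this
    have hl2 : 0 ≤ (j:ℝ) * Real.log 2 := mul_nonneg hjp.le (Real.log_nonneg (by norm_num))
    rw [hfac] at hc
    rw [← Real.log_le_log_iff hG0 (mul_pos (by positivity) (Gbar_pos _ _)),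
      Real.log_mul (by positivity) (Gbar_pos _ _).ne', Real.log_pow, Gbar_eq, Real.log_exp]
    have h6 : (1-α) * Real.log ((j+1).factorial) ≤ (1-α) * (j * Real.log 2 + j * Real.log j) :=
      mul_le_mul_of_nonneg_left hlog (by linarith)
    nlinarith
  have := inv_anti₀ hG0 hup
  refine le_trans (le_of_eq ?_) this
  have hc := Gbar_cancel α j
  have hp := Gbar_pos (1-α) j
  rw [mul_inv, one_div, inv_pow]
  congr 1
  exact eq_inv_of_mul_eq_one_left hc

end UH

namespace UH

/-- quotients -/
def lq (L : ℕ → ℝ) (n : ℕ) : ℝ := L (n+1) / L n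

lemma lq_pos {L : ℕ → ℝ} (hp : ∀ j, 0 < L j) (n : ℕ) : 0 < lq L n := div_pos (hp _) (hp _)

lemma L_succ {L : ℕ → ℝ} (hp : ∀ j, 0 < L j) (n : ℕ) : L (n+1) = L n * lq L n := by
  rw [lq, mul_div_cancel₀ _ (hp n).ne']

lemma lq_mono {L : ℕ → ℝ} (hp : ∀ j, 0 < L j) (hc : IsLogConvexSeq L) : Monotone (lq L) := by
  refine monotone_nat_of_le_succ fun n => ?_
  rw [lq, lq, div_le_div_iff₀ (hp _) (hp _)]
  have := hc n
  nlinarith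

lemma lq_key {L : ℕ → ℝ} (hp : ∀ j, 0 < L j) (hc : IsLogConvexSeq L) (n j : ℕ) :
    L n * lq L n ^ j ≤ L j * lq L n ^ n := by
  have hm := lq_mono hp hc
  have hl := lq_pos hp
  rcases le_total n j with h | h
  · obtain ⟨d, rfl⟩ := Nat.exists_eq_add_of_le h
    have : ∀ d, L n * lq L n ^ d ≤ L (n + d) := by
      intro d
      induction d with
      | zero => simp
      | succ d ih =>
        rw [← add_assoc, L_succ hp, pow_succ, ← mul_assoc]
        exact mul_le_mul ih (hm (by omega)) (hl n).le (hp _).le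
    calc L n * lq L n ^ (n+d) = L n * lq L n ^ d * lq L n ^ n := by ring
      _ ≤ _ := mul_le_mul_of_nonneg_right (this d) (pow_nonneg (hl n).le _)
  · obtain ⟨d, rfl⟩ := Nat.exists_eq_add_of_le h
    have : ∀ d, L (j + d) ≤ L j * lq L (j+d) ^ d := by
      intro d
      induction d with
      | zero => simp
      | succ d ih =>
        rw [← add_assoc, L_succ hp, pow_succ, ← mul_assoc]
        have h1 : lq L (j+d) ≤ lq L (j+d+1) := hm (by omega)
        have h2 := pow_le_pow_left₀ (hl (j+d)).le h1 d
        refine mul_le_mul (ih.trans ?_) h1 (hl _).le (mul_nonneg (hp _).le (pow_nonneg (hl _).le _))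
        exact mul_le_mul_of_nonneg_left h2 (hp _).le
    calc L (j+d) * lq L (j+d) ^ j ≤ L j * lq L (j+d) ^ d * lq L (j+d) ^ j :=
          mul_le_mul_of_nonneg_right (this d) (pow_nonneg (hl _).le _)
      _ = _ := by ring

/-- coefficients -/
def cf (L : ℕ → ℝ) (n j : ℕ) : ℝ := (1/2)^n * (L n / lq L n ^ n) * lq L n ^ j

lemma cf_nonneg {L : ℕ → ℝ} (hp : ∀ j, 0 < L j) (n j : ℕ) : 0 ≤ cf L n j := by
  have := hp n
  have := lq_pos hp n
  unfold cf; positivity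

lemma cf_le {L : ℕ → ℝ} (hp : ∀ j, 0 < L j) (hc : IsLogConvexSeq L) (n j : ℕ) :
    cf L n j ≤ (1/2)^n * L j := by
  have h1 := lq_key hp hc n j
  have h2 := pow_pos (lq_pos hp n) n
  unfold cf
  rw [mul_assoc]
  refine mul_le_mul_of_nonneg_left ?_ (by positivity)
  rw [div_mul_eq_mul_div, div_le_iff₀ h2]
  exact h1

lemma cf_diag {L : ℕ → ℝ} (hp : ∀ j, 0 < L j) (j : ℕ) : cf L j j = (1/2)^j * L j := by
  have h2 := pow_pos (lq_pos hp j) j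
  unfold cf
  field_simp

lemma cf_summable {L : ℕ → ℝ} (hp : ∀ j, 0 < L j) (hc : IsLogConvexSeq L) (j : ℕ) :
    Summable (fun n => cf L n j) :=
  Summable.of_nonneg_of_le (fun n => cf_nonneg hp n j) (fun n => cf_le hp hc n j)
    ((summable_geometric_two).mul_right _)

/-- derivative system of the characteristic function -/
def ff (α : ℝ) (L : ℕ → ℝ) (j : ℕ) (z : ℂ) : ℂ :=
  ∑' n, (cf L n j : ℂ) * V α j ((lq L n : ℂ) * z)

/-- bound for V -/
def BV (α : ℝ) (j : ℕ) : ℝ := KV * Real.exp 1 ^ j * Gbar (α - 1) j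

lemma BV_nonneg (α : ℝ) (j : ℕ) : 0 ≤ BV α j :=
  mul_nonneg (mul_nonneg KV_nonneg (by positivity)) (Gbar_pos _ _).le

lemma ff_term {α : ℝ} (h0 : 0 < α) (h1 : α ≤ 1) {L : ℕ → ℝ} (hp : ∀ j, 0 < L j)
    (hc : IsLogConvexSeq L) (n j : ℕ) {z : ℂ} (hz : z ∈ Sector α) :
    ‖(cf L n j : ℂ) * V α j ((lq L n : ℂ) * z)‖ ≤ (1/2)^n * (L j * BV α j) := by
  have hz' : (lq L n : ℂ) * z ∈ Sector α := sector_smul h0 h1 (lq_pos hp n) hz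
  rw [norm_mul, Complex.norm_real, Real.norm_of_nonneg (cf_nonneg hp n j), ← mul_assoc]
  have a := cf_le hp hc n j
  have b : ‖V α j ((lq L n : ℂ) * z)‖ ≤ BV α j := V_bound h0 h1 j hz'
  have := hp j
  gcongr

lemma ff_deriv {α : ℝ} (h0 : 0 < α) (h1 : α ≤ 1) {L : ℕ → ℝ} (hp : ∀ j, 0 < L j)
    (hc : IsLogConvexSeq L) (j : ℕ) {z : ℂ} (hz : z ∈ Sector α) :
    HasDerivAt (ff α L j) (ff α L (j+1) z) z := by
  have h1S := pos_mem_sector h0 h1 one_pos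
  refine hasDerivAt_tsum_of_isPreconnected
    (g := fun n z => (cf L n j : ℂ) * V α j ((lq L n : ℂ) * z))
    (g' := fun n z => (cf L n (j+1) : ℂ) * V α (j+1) ((lq L n : ℂ) * z))
    (u := fun n => (1/2)^n * (L (j+1) * BV α (j+1))) (summable_geometric_two.mul_right _)
    (sector_open h0 h1) (sector_convex h0 h1).isPreconnected ?_
    (fun n y hy => ff_term h0 h1 hp hc n (j+1) hy) h1S ?_ hz
  · intro n y _
    have h2 : HasDerivAt (fun z => (lq L n : ℂ) * z) ((lq L n : ℂ) * 1) y :=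
      (hasDerivAt_id' y).const_mul _
    have h3 := ((V_deriv h1 j ((lq L n : ℂ) * y)).comp y h2).const_mul (cf L n j : ℂ)
    refine h3.congr_deriv ?_
    have : cf L n (j+1) = cf L n j * lq L n := by unfold cf; ring
    rw [this]; push_cast; ring
  · exact Summable.of_norm_bounded (summable_geometric_two.mul_right _)
      (fun n => ff_term h0 h1 hp hc n j h1S)

lemma ff_bound {α : ℝ} (h0 : 0 < α) (h1 : α ≤ 1) {L : ℕ → ℝ} (hp : ∀ j, 0 < L j)
    (hc : IsLogConvexSeq L) (j : ℕ) {z : ℂ} (hz : z ∈ Sector α) :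
    ‖ff α L j z‖ ≤ 2 * (L j * BV α j) :=
  tsum_of_norm_bounded (hasSum_geometric_two.mul_right _) (fun n => ff_term h0 h1 hp hc n j hz)

lemma ff_lim {α : ℝ} (h0 : 0 < α) (h1 : α ≤ 1) {L : ℕ → ℝ} (hp : ∀ j, 0 < L j)
    (hc : IsLogConvexSeq L) (j : ℕ) :
    Tendsto (fun t : ℝ => ff α L j (t:ℂ)) (𝓝[>] 0)
      (𝓝 ((-1)^j * (((∑' n, cf L n j) * (Real.Gamma ((1-α) * j + 2))⁻¹ : ℝ) : ℂ))) := by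
  have e : (-1)^j * (((∑' n, cf L n j) * (Real.Gamma ((1-α) * j + 2))⁻¹ : ℝ) : ℂ)
      = ∑' n, (cf L n j : ℂ) * V α j 0 := by
    rw [tsum_mul_right, V_zero, ← Complex.ofReal_tsum]; push_cast; ring
  rw [e]
  refine tendsto_tsum_of_dominated_convergence (bound := fun n => (1/2)^n * (L j * BV α j))
    (summable_geometric_two.mul_right _) ?_ ?_
  · intro n
    refine Tendsto.const_mul _ ?_
    have hcont : Continuous (fun t : ℝ => V α j ((lq L n : ℂ) * (t:ℂ))) := by
      have : Continuous (V α j) := continuous_iff_continuousAt.2 fun z => (V_deriv h1 j z).continuousAt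
      fun_prop
    have := hcont.tendsto 0
    simp only [Complex.ofReal_zero, mul_zero] at this
    exact this.mono_left nhdsWithin_le_nhds
  · filter_upwards [self_mem_nhdsWithin] with t ht n
    exact ff_term h0 h1 hp hc n j (pos_mem_sector h0 h1 ht)

lemma iD_system {S : Set ℂ} (hS : IsOpen S) {G : ℕ → ℂ → ℂ}
    (hG : ∀ i, ∀ z ∈ S, HasDerivAt (G i) (G (i+1) z) z) (j : ℕ) :
    ∀ z ∈ S, iteratedDeriv j (G 0) z = G j z := by
  induction j with
  | zero => intro z _; simp
  | succ j ih =>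
    intro z hz
    rw [iteratedDeriv_succ]
    have : iteratedDeriv j (G 0) =ᶠ[𝓝 z] G j := by
      filter_upwards [hS.mem_nhds hz] with w hw using ih w hw
    rw [this.deriv_eq, (hG j z hz).deriv]

theorem char_fun {α : ℝ} (h0 : 0 < α) (h1 : α ≤ 1) {L : ℕ → ℝ} (hp : ∀ j, 0 < L j)
    (hc : IsLogConvexSeq L) : ∃ (f : ℂ → ℂ) (s : ℕ → ℝ) (K : ℝ), 0 ≤ K ∧
      DifferentiableOn ℂ f (Sector α) ∧
      (∀ j, ∀ z ∈ Sector α, ‖iteratedDeriv j f z‖ ≤ K * Real.exp 1 ^ j * (Gbar (α-1) j * L j)) ∧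
      (∀ j, Tendsto (fun t : ℝ => iteratedDeriv j f (t:ℂ)) (𝓝[>] 0)
        (𝓝 ((-1)^j * (j.factorial * (s j : ℂ))))) ∧
      (∀ j, (1/4)^j * (Gbar (α-1) j * L j / j.factorial) ≤ s j) := by
  have hsys := iD_system (sector_open h0 h1) (G := ff α L)
    (fun i z hz => ff_deriv h0 h1 hp hc i hz)
  refine ⟨ff α L 0, fun j => (∑' n, cf L n j) * (Real.Gamma ((1-α) * j + 2))⁻¹ / j.factorial,
    2 * KV, mul_nonneg (by norm_num) KV_nonneg, ?_, ?_, ?_, ?_⟩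
  · exact fun z hz => (ff_deriv h0 h1 hp hc 0 hz).differentiableAt.differentiableWithinAt
  · intro j z hz
    rw [hsys j z hz]
    refine (ff_bound h0 h1 hp hc j hz).trans (le_of_eq ?_)
    unfold BV; ring
  · intro j
    have h := ff_lim h0 h1 hp hc j
    have hfac : (j.factorial : ℂ) ≠ 0 := by exact_mod_cast Nat.factorial_ne_zero j
    have e : ((j.factorial : ℂ) * (((∑' n, cf L n j) * (Real.Gamma ((1-α) * j + 2))⁻¹ / j.factorial : ℝ) : ℂ))
        = (((∑' n, cf L n j) * (Real.Gamma ((1-α) * j + 2))⁻¹ : ℝ) : ℂ) := by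
      push_cast; field_simp
    rw [e]
    refine h.congr' ?_
    filter_upwards [self_mem_nhdsWithin] with t ht
    exact (hsys j _ (pos_mem_sector h0 h1 ht)).symm
  · intro j
    have a : (1/2)^j * L j ≤ ∑' n, cf L n j := by
      rw [← cf_diag hp j]
      exact (cf_summable hp hc j).le_tsum j (fun n _ => cf_nonneg hp n j)
    have b := gamma_upper h0 h1 j
    have hg := Gbar_pos (α-1) j
    have hL := hp j
    have hfac : (0:ℝ) < j.factorial := by positivity
    rw [← mul_div_assoc]
    refine div_le_div_of_nonneg_right ?_ hfac.le
    calc (1/4:ℝ)^j * (Gbar (α-1) j * L j) = ((1/2)^j * L j) * ((1/2)^j * Gbar (α-1) j) := by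
          rw [show (1/4:ℝ) = 1/2 * (1/2) by norm_num, mul_pow]; ring
      _ ≤ _ := by
          refine mul_le_mul a b (by positivity) ?_
          exact le_trans (by positivity) a

/-- monotonicity of `L_k^{1/k}` in logarithmic form -/
lemma log_root_mono {L : ℕ → ℝ} (hp : ∀ j, 0 < L j) (hc : IsLogConvexSeq L) (hL0 : L 0 ≤ 1)
    {m k : ℕ} (hm : 1 ≤ m) (hmk : m ≤ k) : Real.log (L m) / m ≤ Real.log (L k) / k := by
  induction k, hmk using Nat.le_induction with
  | base => exact le_rfl
  | succ k hk ih =>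
    refine ih.trans ?_
    have hk0 : (0:ℝ) < k := by exact_mod_cast (by omega : 0 < k)
    have h1 := lq_key hp hc k 0
    rw [pow_zero, mul_one] at h1
    have hl := lq_pos hp k
    have h2 : L k ≤ lq L k ^ k := h1.trans (by
      have := pow_pos hl k
      nlinarith)
    have h3 := Real.log_le_log (hp k) h2
    rw [Real.log_pow] at h3
    have h4 : Real.log (L (k+1)) = Real.log (L k) + Real.log (lq L k) := by
      rw [L_succ hp, Real.log_mul (hp k).ne' hl.ne']
    rw [div_le_div_iff₀ hk0 (by positivity), h4]
    push_cast
    nlinarith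

lemma root_compare {α : ℝ} (h1 : α ≤ 1) {L : ℕ → ℝ} (hp : ∀ j, 0 < L j)
    (hc : IsLogConvexSeq L) (hL0 : L 0 ≤ 1) {m k : ℕ} (hm : 1 ≤ m) (hmk : m ≤ k) (hk2 : k ≤ 2 * m)
    (h0 : 0 < α) :
    (Gbar (α-1) m * L m / m.factorial) ^ ((m:ℝ)⁻¹) ≤
      Real.exp (1 + 2 * Real.log 2) * (Gbar (α-1) k * L k / k.factorial) ^ ((k:ℝ)⁻¹) := by
  have hw : ∀ n, 0 < Gbar (α-1) n * L n / n.factorial := fun n =>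
    div_pos (mul_pos (Gbar_pos _ _) (hp n)) (by positivity)
  have hm0 : (0:ℝ) < m := by exact_mod_cast hm
  have hk0 : (0:ℝ) < k := by exact_mod_cast (by omega : 0 < k)
  have hlw : ∀ n : ℕ, 1 ≤ n → Real.log (Gbar (α-1) n * L n / n.factorial) * (n:ℝ)⁻¹
      = (α-1) * Real.log n + Real.log (L n) / n - Real.log n.factorial / n := by
    intro n hn
    have hn0 : (0:ℝ) < n := by exact_mod_cast hn
    rw [Real.log_div (mul_pos (Gbar_pos _ _) (hp n)).ne' (by positivity),
      Real.log_mul (Gbar_pos _ _).ne' (hp n).ne', Gbar_eq, Real.log_exp]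
    field_simp
  rw [Real.rpow_def_of_pos (hw m), Real.rpow_def_of_pos (hw k), ← Real.exp_add, Real.exp_le_exp,
    hlw m hm, hlw k (by omega)]
  have a := log_root_mono hp hc hL0 hm hmk
  have b : Real.log k ≤ Real.log 2 + Real.log m := by
    rw [← Real.log_mul (by norm_num) hm0.ne']
    exact Real.log_le_log hk0 (by exact_mod_cast hk2)
  have hl2 : 0 ≤ Real.log 2 := Real.log_nonneg (by norm_num)
  have c : Real.log m - 1 ≤ Real.log m.factorial / m := by
    rw [le_div_iff₀ hm0]
    have := le_log_fact m
    nlinarith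
  have d : Real.log k.factorial / k ≤ Real.log k := by
    rw [div_le_iff₀ hk0]
    have := log_fact_le k
    nlinarith
  have e : (1-α) * (Real.log k - Real.log m) ≤ Real.log 2 := by
    have : (1-α) * (Real.log k - Real.log m) ≤ (1-α) * Real.log 2 :=
      mul_le_mul_of_nonneg_left (by linarith) (by linarith)
    nlinarith
  nlinarith

end UH

namespace UH

lemma ps_rec {q : ℕ → ℝ} (hq : q 0 ≠ 0) : ∃ γ : ℕ → ℝ, ∀ k,
    q 0 * γ k = (if k = 0 then 1 else 0) - ∑ i ∈ Finset.range k, q (i+1) * γ (k - (i+1)) := by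
  let P : PowerSeries ℝ := PowerSeries.mk q
  have hP : PowerSeries.constantCoeff P ≠ 0 := by
    simpa [P, ← PowerSeries.coeff_zero_eq_constantCoeff_apply] using hq
  refine ⟨fun k => PowerSeries.coeff k P⁻¹, fun k => ?_⟩
  have h := congrArg (PowerSeries.coeff k) (PowerSeries.mul_inv_cancel P hP)
  rw [PowerSeries.coeff_mul, PowerSeries.coeff_one,
    Finset.Nat.sum_antidiagonal_eq_sum_range_succ_mk, Finset.sum_range_succ'] at h
  simp only [P, PowerSeries.coeff_mk, Nat.sub_zero] at h
  linarith

lemma leib {S : Set ℂ} (hS : IsOpen S) {A F : ℂ → ℂ} (hA : DifferentiableOn ℂ A S)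
    (hF : DifferentiableOn ℂ F S) (h : ∀ z ∈ S, A z * F z = 1) (k : ℕ) {z : ℂ} (hz : z ∈ S) :
    ∑ i ∈ Finset.range (k+1), (iteratedDeriv i A z / i.factorial) *
      (iteratedDeriv (k-i) F z / (k-i).factorial) = if k = 0 then 1 else 0 := by
  have h1 : (fun w => A w * F w) =ᶠ[𝓝 z] fun _ => 1 := by
    filter_upwards [hS.mem_nhds hz] with w hw using h w hw
  have h2 := h1.iteratedDeriv_eq k
  rw [iteratedDeriv_fun_mul (hA.analyticAt (hS.mem_nhds hz)).contDiffAt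
    (hF.analyticAt (hS.mem_nhds hz)).contDiffAt, iteratedDeriv_const] at h2
  have hk : (k.factorial : ℂ) ≠ 0 := by exact_mod_cast Nat.factorial_ne_zero k
  have h3 : (k.factorial : ℂ) * ∑ i ∈ Finset.range (k+1), (iteratedDeriv i A z / i.factorial) *
      (iteratedDeriv (k-i) F z / (k-i).factorial) = if k = 0 then 1 else 0 := by
    rw [← h2, Finset.mul_sum]
    refine Finset.sum_congr rfl fun i hi => ?_
    have hi' : i ≤ k := by simpa [Nat.lt_succ_iff] using hi
    have e := Nat.choose_mul_factorial_mul_factorial hi'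
    have e' : (k.choose i : ℂ) * i.factorial * (k-i).factorial = k.factorial := by exact_mod_cast e
    have a1 : (i.factorial : ℂ) ≠ 0 := by exact_mod_cast Nat.factorial_ne_zero i
    have a2 : ((k-i).factorial : ℂ) ≠ 0 := by exact_mod_cast Nat.factorial_ne_zero (k-i)
    rw [← e']
    field_simp
  by_cases hk0 : k = 0
  · subst hk0; simpa using h3
  · rw [if_neg hk0] at h3 ⊢
    exact (mul_eq_zero.1 h3).resolve_left hk

lemma lim_inv {S : Set ℂ} (hS : IsOpen S) (hpos : ∀ t : ℝ, 0 < t → (t:ℂ) ∈ S)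
    {A F : ℂ → ℂ} (hA : DifferentiableOn ℂ A S)
    (hF : DifferentiableOn ℂ F S) (h : ∀ z ∈ S, A z * F z = 1) {q γ : ℕ → ℝ} (hq : q 0 ≠ 0)
    (hγ : ∀ k, q 0 * γ k = (if k = 0 then 1 else 0) - ∑ i ∈ Finset.range k, q (i+1) * γ (k - (i+1)))
    (hlim : ∀ i, Tendsto (fun t : ℝ => iteratedDeriv i A (t:ℂ) / i.factorial) (𝓝[>] 0)
      (𝓝 ((-1)^i * (q i : ℂ)))) (k : ℕ) :
    Tendsto (fun t : ℝ => iteratedDeriv k F (t:ℂ) / k.factorial) (𝓝[>] 0)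
      (𝓝 ((-1)^k * (γ k : ℂ))) := by
  induction k using Nat.strong_induction_on with
  | _ k ih =>
    have hq' : ((q 0 : ℝ) : ℂ) ≠ 0 := by exact_mod_cast hq
    have h1 : Tendsto (fun t : ℝ => (A (t:ℂ))⁻¹ * ((if k = 0 then 1 else 0) -
        ∑ i ∈ Finset.range k, (iteratedDeriv (i+1) A (t:ℂ) / (i+1).factorial) *
          (iteratedDeriv (k-(i+1)) F (t:ℂ) / (k-(i+1)).factorial))) (𝓝[>] 0)
        (𝓝 ((q 0 : ℂ)⁻¹ * ((if k = 0 then 1 else 0) -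
        ∑ i ∈ Finset.range k, ((-1)^(i+1) * (q (i+1) : ℂ)) * ((-1)^(k-(i+1)) * (γ (k-(i+1)) : ℂ))))) := by
      refine Tendsto.mul ?_ (tendsto_const_nhds.sub ?_)
      · have := (hlim 0).inv₀ (by simpa using hq')
        simpa using this
      · refine tendsto_finsetSum _ fun i hi => ?_
        have hi' : i < k := by simpa using hi
        exact (hlim (i+1)).mul (ih (k-(i+1)) (by omega))
    have e : (q 0 : ℂ)⁻¹ * ((if k = 0 then 1 else 0) -
        ∑ i ∈ Finset.range k, ((-1)^(i+1) * (q (i+1) : ℂ)) * ((-1)^(k-(i+1)) * (γ (k-(i+1)) : ℂ)))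
        = (-1)^k * (γ k : ℂ) := by
      have h2 : ((q 0 * γ k : ℝ) : ℂ) = (if k = 0 then 1 else 0) -
          ∑ i ∈ Finset.range k, (q (i+1) : ℂ) * (γ (k - (i+1)) : ℂ) := by
        rw [hγ k]; push_cast
        congr 1
        split_ifs <;> simp
      have h3 : ∑ i ∈ Finset.range k, ((-1)^(i+1) * (q (i+1) : ℂ)) * ((-1)^(k-(i+1)) * (γ (k-(i+1)) : ℂ))
          = (-1)^k * ∑ i ∈ Finset.range k, (q (i+1) : ℂ) * (γ (k - (i+1)) : ℂ) := by
        rw [Finset.mul_sum]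
        refine Finset.sum_congr rfl fun i hi => ?_
        have hi' : i < k := by simpa using hi
        have : (-1:ℂ)^k = (-1)^(i+1) * (-1)^(k-(i+1)) := by rw [← pow_add]; congr 1; omega
        rw [this]; ring
      have h4 : (if k = 0 then (1:ℂ) else 0) = (-1)^k * (if k = 0 then 1 else 0) := by
        split_ifs with hk
        · simp [hk]
        · simp
      rw [h3, h4, ← mul_sub, ← h2]
      push_cast
      field_simp
    rw [e] at h1
    refine h1.congr' ?_
    filter_upwards [self_mem_nhdsWithin] with t ht
    have hz := hpos t ht
    have h5 := leib hS hA hF h k hz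
    rw [Finset.sum_range_succ'] at h5
    simp only [Nat.sub_zero, iteratedDeriv_zero, Nat.factorial_zero, Nat.cast_one, div_one] at h5
    have hA0 : A (t:ℂ) ≠ 0 := left_ne_zero_of_mul_eq_one (h _ hz)
    rw [← h5]
    field_simp
    ring

lemma gamma_growth {q γ s : ℕ → ℝ} {lam : ℝ} (hs : ∀ j, 0 < s j) (hq0 : 0 < q 0) (hq0' : q 0 ≤ lam)
    (hqs : ∀ i, q (i+1) = - s (i+1))
    (hγ : ∀ k, q 0 * γ k = (if k = 0 then 1 else 0) - ∑ i ∈ Finset.range k, q (i+1) * γ (k - (i+1))) :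
    (∀ k, 0 < γ k) ∧ ∀ j n, 1 ≤ j → (s j / lam) ^ n * lam⁻¹ ≤ γ (n * j) := by
  have hlam : 0 < lam := by linarith
  have hγ' : ∀ k, q 0 * γ k = (if k = 0 then 1 else 0) + ∑ i ∈ Finset.range k, s (i+1) * γ (k - (i+1)) := by
    intro k
    rw [hγ k]
    simp only [hqs, neg_mul, Finset.sum_neg_distrib, sub_neg_eq_add]
  have hpos : ∀ k, 0 < γ k := by
    intro k
    induction k using Nat.strong_induction_on with
    | _ k ih =>
      have : 0 < q 0 * γ k := by
        rw [hγ' k]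
        rcases k with _ | k
        · simp
        · rw [if_neg (by omega), zero_add]
          refine Finset.sum_pos (fun i hi => mul_pos (hs _) (ih _ (by omega))) (by simp)
      exact pos_of_mul_pos_right this hq0.le
  have hstep : ∀ j k, 1 ≤ j → s j * γ k ≤ lam * γ (k + j) := by
    intro j k hj
    have h1 : s j * γ k ≤ q 0 * γ (k+j) := by
      rw [hγ' (k+j), if_neg (by omega), zero_add]
      have := Finset.single_le_sum (f := fun i => s (i+1) * γ (k + j - (i+1))) (s := Finset.range (k+j))
        (fun i _ => (mul_pos (hs _) (hpos _)).le) (Finset.mem_range.2 (by omega : j - 1 < k + j))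
      rwa [show j - 1 + 1 = j by omega, show k + j - j = k by omega] at this
    have := hpos (k+j)
    nlinarith
  refine ⟨hpos, fun j n hj => ?_⟩
  induction n with
  | zero =>
    have h0 := hγ' 0
    simp at h0
    simp only [pow_zero, one_mul, zero_mul]
    rw [inv_le_iff_one_le_mul₀ hlam]
    have := hpos 0
    nlinarith
  | succ n ih =>
    have h1 := hstep j (n*j) hj
    rw [Nat.succ_mul]
    have h2 : s j / lam * γ (n*j) ≤ γ (n*j+j) := by
      rw [div_mul_eq_mul_div, div_le_iff₀ hlam]; linarith
    refine le_trans ?_ h2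
    rw [pow_succ']
    calc s j / lam * (s j / lam) ^ n * lam⁻¹ = s j / lam * ((s j / lam)^n * lam⁻¹) := by ring
      _ ≤ _ := mul_le_mul_of_nonneg_left ih (div_pos (hs j) hlam).le

lemma c_imp_a {M : ℝ → ℕ → ℝ} (hM : IsWeightMatrix M)
    {α : ℝ} (hα : 0 < α) (hα1 : α ≤ 1) {Lmin : ℝ → ℕ → ℝ}
    (hLmin : ∀ p > (0:ℝ), IsLcMinorant (fun j => Gbar (1 - α) j * M p j) (Lmin p))
    (hinv : InvClosed (AMatSet M α) α) : Mrai (fun p j => Gbar (α - 1) j * Lmin p j) := by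
  intro p hp
  have hSo := sector_open hα hα1
  have hNpos : ∀ q > 0, ∀ j, 0 < Gbar (α-1) j * Lmin q j :=
    fun q hq j => mul_pos (Gbar_pos _ _) ((hLmin q hq).1 j)
  obtain ⟨f, s, K, hK, hfd, hfb, hfl, hsl⟩ := char_fun hα hα1 (hLmin p hp).1 (hLmin p hp).2.1
  have hs : ∀ j, 0 < s j := fun j => lt_of_lt_of_le
    (mul_pos (by positivity) (div_pos (hNpos p hp j) (by positivity))) (hsl j)
  have hfK : ∀ z ∈ Sector α, ‖f z‖ ≤ K := by
    intro z hz
    have h1 := hfb 0 z hz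
    have h2 := N_le_M (hLmin p hp) 0
    rw [hM.2.1 p hp] at h2
    simp only [iteratedDeriv_zero, pow_zero, mul_one] at h1
    nlinarith
  set lam : ℝ := K + 1 with hlam
  have hlam1 : 1 ≤ lam := by linarith
  set A : ℂ → ℂ := fun z => (lam : ℂ) - f z with hA
  have hAd : DifferentiableOn ℂ A (Sector α) := hfd.const_sub _
  have hAi : ∀ i z, iteratedDeriv (i+1) A z = - iteratedDeriv (i+1) f z := by
    intro i z
    have := iteratedDeriv_const_sub (n := i+1) (f := f) (x := z) (by omega) (lam : ℂ)
    rw [hA, this, iteratedDeriv_neg]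
  have hA1 : ∀ z ∈ Sector α, 1 ≤ ‖A z‖ := by
    intro z hz
    have h1 := norm_sub_norm_le (lam:ℂ) (f z)
    rw [Complex.norm_real, Real.norm_of_nonneg (by linarith)] at h1
    have := hfK z hz
    simp only [hA]; linarith
  have hA0 : ∀ z ∈ Sector α, A z ≠ 0 := by
    intro z hz h0
    have := hA1 z hz
    rw [h0, norm_zero] at this
    linarith
  have hAmem : A ∈ AMatSet M α := by
    refine ⟨p, hp, mem_of_bound hα hα1 hAd (C := lam + K) (Real.exp_pos 1) ?_⟩
    intro j z hz
    rcases j with _ | j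
    · simp only [iteratedDeriv_zero, pow_zero, mul_one, hM.2.1 p hp]
      have h1 := norm_sub_le (lam:ℂ) (f z)
      rw [Complex.norm_real, Real.norm_of_nonneg (by linarith)] at h1
      have := hfK z hz
      simp only [hA]; linarith
    · rw [hAi, norm_neg]
      refine (hfb (j+1) z hz).trans ?_
      have h2 := N_le_M (hLmin p hp) (j+1)
      have := (hNpos p hp (j+1)).le
      gcongr
      linarith
  obtain ⟨p', hp', hFmem⟩ := hinv A hAmem ⟨1, one_pos, hA1⟩
  obtain ⟨C, hC, h, hh, hFb⟩ := reg_of_mem hα hα1 (hM.1 p' hp') (hLmin p' hp') hFmem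
  set F : ℂ → ℂ := fun z => (A z)⁻¹ with hF
  -- limits
  set q : ℕ → ℝ := fun i => if i = 0 then lam - s 0 else - s i with hq
  have hs0K : s 0 ≤ K := by
    have h1 := (hfl 0).norm
    simp only [pow_zero, one_mul, Nat.factorial_zero, Nat.cast_one, iteratedDeriv_zero] at h1
    rw [Complex.norm_real, Real.norm_of_nonneg (hs 0).le] at h1
    refine le_of_tendsto h1 ?_
    filter_upwards [self_mem_nhdsWithin] with t ht
    exact hfK _ (pos_mem_sector hα hα1 ht)
  have hq0 : q 0 = lam - s 0 := by simp [hq]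
  have hqs : ∀ i, q (i+1) = - s (i+1) := fun i => by simp [hq]
  have hq0pos : 0 < q 0 := by rw [hq0]; linarith
  have hq0le : q 0 ≤ lam := by rw [hq0]; linarith [hs 0]
  obtain ⟨γ, hγ⟩ := ps_rec hq0pos.ne'
  obtain ⟨hγpos, hγgrow⟩ := gamma_growth hs hq0pos hq0le hqs hγ
  have hAl : ∀ i, Tendsto (fun t : ℝ => iteratedDeriv i A (t:ℂ) / i.factorial) (𝓝[>] 0)
      (𝓝 ((-1)^i * (q i : ℂ))) := by
    intro i
    rcases i with _ | i
    · have h1 := (hfl 0)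
      simp only [pow_zero, one_mul, Nat.factorial_zero, Nat.cast_one, iteratedDeriv_zero] at h1
      have h2 := (tendsto_const_nhds (x := (lam:ℂ))).sub h1
      simp only [pow_zero, one_mul, Nat.factorial_zero, Nat.cast_one, iteratedDeriv_zero, div_one, hq0]
      push_cast
      exact h2
    · have h1 := ((hfl (i+1)).div_const ((i+1).factorial : ℂ)).neg
      have hfac : (((i+1).factorial : ℕ) : ℂ) ≠ 0 := by exact_mod_cast Nat.factorial_ne_zero (i+1)
      have e : -((-1) ^ (i+1) * (((i+1).factorial : ℂ) * (s (i+1) : ℂ)) / ((i+1).factorial : ℂ))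
          = (-1)^(i+1) * (q (i+1) : ℂ) := by
        rw [hqs]; push_cast; field_simp
      rw [e] at h1
      refine h1.congr fun t => ?_
      rw [hAi, neg_div]
  have hFl := lim_inv hSo (fun t ht => pos_mem_sector hα hα1 ht) hAd hFmem.1
    (fun z hz => mul_inv_cancel₀ (hA0 z hz)) hq0pos.ne' hγ hAl
  have hγup : ∀ k, γ k ≤ C * h ^ k * (Gbar (α-1) k * Lmin p' k / k.factorial) := by
    intro k
    have h1 := (hFl k).norm
    have e : ‖(-1:ℂ)^k * (γ k : ℂ)‖ = γ k := by
      rw [norm_mul, norm_pow, norm_neg, norm_one, one_pow, one_mul, Complex.norm_real,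
        Real.norm_of_nonneg (hγpos k).le]
    rw [e] at h1
    refine le_of_tendsto h1 ?_
    filter_upwards [self_mem_nhdsWithin] with t ht
    have h2 := hFb k _ (pos_mem_sector hα hα1 ht)
    rw [norm_div, Complex.norm_natCast, ← mul_div_assoc]
    exact div_le_div_of_nonneg_right h2 (by positivity)
  set C1 : ℝ := max C 1 with hC1
  have hC1' : 1 ≤ C1 := le_max_right _ _
  set E : ℝ := 4 * h * lam ^ 2 * C1 with hE
  have hE0 : 0 < E := by positivity
  have hL0 : Lmin p' 0 ≤ 1 := by
    have := (hLmin p' hp').2.2.1 0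
    simpa [Gbar, hM.2.1 p' hp'] using this
  refine ⟨E * Real.exp (1 + 2 * Real.log 2), by positivity, p', hp', ?_⟩
  intro j k hj hjk
  simp only [checkSeq]
  set n := k / j with hn
  have hn1 : 1 ≤ n := (Nat.one_le_div_iff (by omega)).2 hjk
  have hmk : n * j ≤ k := Nat.div_mul_le_self k j
  have hk2 : k ≤ 2 * (n * j) := by
    have : k < (n+1) * j := by
      have := Nat.lt_div_mul_add (a := k) (b := j) (by omega)
      rw [Nat.succ_mul]; exact this
    nlinarith
  have hm1 : 1 ≤ n * j := Nat.one_le_iff_ne_zero.2 (by positivity)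
  set w := Gbar (α-1) j * Lmin p j / j.factorial with hw
  have hw0 : 0 < w := div_pos (hNpos p hp j) (by positivity)
  set m := n * j with hm
  set w' := Gbar (α-1) m * Lmin p' m / m.factorial with hw'
  have hw'0 : 0 < w' := div_pos (hNpos p' hp' m) (by positivity)
  have hmain : w ^ n ≤ E ^ m * w' := by
    have h1 := hγgrow j n hj
    have h2 := hγup m
    have h3 := hsl j
    have h4 : ((1/4)^j * w / lam) ^ n * lam⁻¹ ≤ C * h ^ m * w' := by
      refine le_trans ?_ (h1.trans h2)
      gcongr
    have h5 : ((1/4)^j * w / lam) ^ n * lam⁻¹ = w ^ n / (4 ^ m * lam ^ (n+1)) := by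
      rw [div_pow, mul_pow, ← pow_mul, mul_comm j n, ← hm, one_div, inv_pow, pow_succ]
      field_simp
    rw [h5, div_le_iff₀ (by positivity)] at h4
    refine h4.trans ?_
    have h6 : lam ^ (n+1) ≤ (lam ^ 2) ^ m := by
      rw [← pow_mul]
      refine pow_le_pow_right₀ hlam1 ?_
      nlinarith
    have h7 : C ≤ C1 ^ m := (le_max_left _ _).trans (le_self_pow₀ hC1' (by omega))
    calc C * h ^ m * w' * (4 ^ m * lam ^ (n+1)) ≤ C1 ^ m * h ^ m * w' * (4 ^ m * (lam ^ 2) ^ m) := by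
          gcongr
      _ = E ^ m * w' := by rw [hE, mul_pow, mul_pow, mul_pow]; ring
  have hroot : w ^ ((j:ℝ)⁻¹) ≤ E * w' ^ ((m:ℝ)⁻¹) := by
    have hj0 : (0:ℝ) < j := by exact_mod_cast hj
    have hn0 : (0:ℝ) < n := by exact_mod_cast hn1
    have hm0 : (0:ℝ) < m := by exact_mod_cast hm1
    have h1 := Real.rpow_le_rpow (by positivity) hmain (z := (m:ℝ)⁻¹) (by positivity)
    rw [Real.mul_rpow (by positivity) hw'0.le, Real.pow_rpow_inv_natCast hE0.le (by omega),
      ← Real.rpow_natCast w n, ← Real.rpow_mul hw0.le] at h1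
    have e : (n:ℝ) * (m:ℝ)⁻¹ = (j:ℝ)⁻¹ := by
      rw [hm]; push_cast; field_simp
    rwa [e] at h1
  have hcmp := root_compare hα1 (hLmin p' hp').1 (hLmin p' hp').2.1 hL0 hm1 hmk hk2 hα
  calc w ^ ((j:ℝ)⁻¹) ≤ E * w' ^ ((m:ℝ)⁻¹) := hroot
    _ ≤ E * (Real.exp (1 + 2 * Real.log 2) * (Gbar (α-1) k * Lmin p' k / k.factorial) ^ ((k:ℝ)⁻¹)) :=
        mul_le_mul_of_nonneg_left hcmp hE0.le
    _ = _ := by ring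

end UH

/-- for `0 < α ≤ 1`, equivalence of `(𝓜_{rai})` for the regularized matrix
`𝓜^α`, holomorphic closedness, and inverse closedness of `A_{{𝓜}}(S_α)`. -/
theorem stmt_8 (M : ℝ → ℕ → ℝ) (hM : IsWeightMatrix M)
    (α : ℝ) (hα : 0 < α) (hα1 : α ≤ 1)
    (hlim : ∀ p > (0:ℝ), Filter.Tendsto
      (fun j : ℕ => (Gbar (1 - α) j * M p j) ^ ((j:ℝ)⁻¹)) Filter.atTop Filter.atTop)
    (Lmin : ℝ → ℕ → ℝ)
    (hLmin : ∀ p > (0:ℝ), IsLcMinorant (fun j => Gbar (1 - α) j * M p j) (Lmin p)) :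
    (Mrai (fun p j => Gbar (α - 1) j * Lmin p j) ↔ HolClosed (AMatSet M α) α) ∧
    (HolClosed (AMatSet M α) α ↔ InvClosed (AMatSet M α) α) := by
  have ab := fun h => UH.a_imp_b hM hα hα1 hLmin h
  have bc := fun h => UH.b_imp_c (M := M) (α := α) h
  have ca := fun h => UH.c_imp_a hM hα hα1 hLmin h
  exact ⟨⟨ab, fun h => ca (bc h)⟩, ⟨bc, fun h => ab (ca h)⟩⟩
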